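/- arXiv:1303.7100 — 4 statements merged into one kernel-verified Lean document; each statement's English description precedes it below -/
import Mathlib

section
/- Under Assumptions (H) and (H1), for every λ > 0 and every f ∈ X the function [𝔅_λ f](s) = ∫₀^s e^{−λ(s−τ)} B(s)U(s,τ)f(τ) dτ (defined for a.e. s ≥ 0) belongs to X = L¹(ℝ₊,E), and ‖𝔅_λ f‖_X ≤ ‖f‖_X for every f ∈ X₊; in particular 𝔅_λ is a bounded linear operator on X. -/
open MeasureTheory Set Filter Topology

/-- An abstract state space: a real normed space together with a generating positive
cone on which the norm is additive, an evolution family `U`, and a family of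
(unbounded) nonnegative operators `B t` with domains `DB t`, satisfying
Assumptions (H) of the paper. -/
structure PerturbedSetting (E : Type*) [NormedAddCommGroup E] [NormedSpace ℝ E] where
  pos : Set E
  zero_mem : (0 : E) ∈ pos
  add_mem : ∀ u v : E, u ∈ pos → v ∈ pos → u + v ∈ pos
  smul_mem : ∀ c : ℝ, 0 ≤ c → ∀ u ∈ pos, c • u ∈ pos
  generating : ∀ u : E, ∃ v w : E, v ∈ pos ∧ w ∈ pos ∧ u = v - w
  norm_add : ∀ u v : E, u ∈ pos → v ∈ pos → ‖u + v‖ = ‖u‖ + ‖v‖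
  U : ℝ → ℝ → E →L[ℝ] E
  U_cont : ∀ u : E, ContinuousOn (fun p : ℝ × ℝ => U p.1 p.2 u)
    {p : ℝ × ℝ | 0 ≤ p.2 ∧ p.2 ≤ p.1}
  U_comp : ∀ t r s : ℝ, 0 ≤ s → s ≤ r → r ≤ t → ∀ u : E, U t s u = U t r (U r s u)
  U_id : ∀ t : ℝ, 0 ≤ t → ∀ u : E, U t t u = u
  U_bound : ∃ C β : ℝ, 0 < C ∧ 0 < β ∧
    ∀ t s : ℝ, 0 ≤ s → s ≤ t → ‖U t s‖ ≤ C * Real.exp (β * (t - s))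
  DB : ℝ → Set E
  B : ℝ → E → E
  DB_zero : ∀ t : ℝ, (0 : E) ∈ DB t
  DB_add : ∀ t : ℝ, ∀ u ∈ DB t, ∀ v ∈ DB t, u + v ∈ DB t
  DB_smul : ∀ t c : ℝ, ∀ u ∈ DB t, c • u ∈ DB t
  B_add : ∀ t : ℝ, ∀ u ∈ DB t, ∀ v ∈ DB t, B t (u + v) = B t u + B t v
  B_smul : ∀ t c : ℝ, ∀ u ∈ DB t, B t (c • u) = c • B t u
  U_pos : ∀ t s : ℝ, 0 ≤ s → s ≤ t → ∀ u ∈ pos, U t s u ∈ pos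
  U_contr : ∀ t s : ℝ, 0 ≤ s → s ≤ t → ∀ u ∈ pos, ‖U t s u‖ ≤ ‖u‖
  B_pos : ∀ t : ℝ, 0 ≤ t → ∀ u ∈ DB t, u ∈ pos → B t u ∈ pos
  BU_dom : ∀ (u : E) (s : ℝ), 0 ≤ s →
    ∀ᵐ t ∂(volume.restrict (Set.Ici s)), U t s u ∈ DB t
  BU_meas : ∀ (u : E) (s : ℝ), 0 ≤ s →
    AEStronglyMeasurable (fun t => B t (U t s u)) (volume.restrict (Set.Ici s))
  BU_integrable : ∀ u ∈ pos, ∀ s t : ℝ, 0 ≤ s → s ≤ t →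
    IntegrableOn (fun τ => B τ (U τ s u)) (Set.Ioc s t) volume
  BU_int : ∀ u ∈ pos, ∀ s t : ℝ, 0 ≤ s → s ≤ t →
    (∫ τ in s..t, ‖B τ (U τ s u)‖) ≤ ‖u‖ - ‖U t s u‖


/-- The binary digits of a real number. -/
noncomputable def hdig (n : ℕ) (x : ℝ) : ℤ := ⌊2 ^ (n + 1) * x⌋ % 2

lemma hdig_measurable (n : ℕ) : Measurable (hdig n) := by
  unfold hdig
  exact (measurable_from_top (f := fun k : ℤ => k % 2)).comp
    (Int.measurable_floor.comp (measurable_const.mul measurable_id))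

lemma hdig_eq (n : ℕ) (x : ℝ) : hdig n x = 0 ∨ hdig n x = 1 := by
  unfold hdig; omega

lemma hdig_floor_low (m j : ℕ) (x : ℝ) :
    ⌊2 ^ (m + 1) * x⌋ = ⌊2 ^ (m + 1 + j) * x⌋ / (2 ^ j : ℕ) := by
  rw [← Int.floor_div_natCast]
  congr 1
  push_cast
  rw [pow_add 2 (m + 1) j]
  field_simp

lemma hdig_shift_self (n : ℕ) (x : ℝ) :
    ⌊2 ^ (n + 1) * (x + 1 / 2 ^ (n + 1))⌋ = ⌊2 ^ (n + 1) * x⌋ + 1 := by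
  rw [← Int.floor_add_one]
  congr 1
  field_simp

lemma hdig_shift_ne (n m : ℕ) (hmn : m ≠ n) (x : ℝ) (h0 : hdig n x = 0) :
    hdig m (x + 1 / 2 ^ (n + 1)) = hdig m x := by
  rcases lt_or_gt_of_ne hmn with h | h
  · obtain ⟨j, rfl⟩ : ∃ j, n = m + (j + 1) := ⟨n - m - 1, by omega⟩
    unfold hdig at h0 ⊢
    rw [hdig_floor_low m (j + 1) x, hdig_floor_low m (j + 1) (x + _)]
    have e : m + 1 + (j + 1) = m + (j + 1) + 1 := by ring
    rw [e, hdig_shift_self]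
    congr 1
    set k := ⌊(2:ℝ) ^ (m + (j + 1) + 1) * x⌋
    push_cast
    rw [pow_succ' (2:ℤ) j, ← Int.ediv_ediv_of_nonneg (by norm_num),
      ← Int.ediv_ediv_of_nonneg (by norm_num)]
    congr 1
    omega
  · obtain ⟨j, rfl⟩ : ∃ j, m = n + (j + 1) := ⟨m - n - 1, by omega⟩
    unfold hdig
    have : (2:ℝ) ^ (n + (j + 1) + 1) * (x + 1 / 2 ^ (n + 1))
        = 2 ^ (n + (j + 1) + 1) * x + ((2 * 2 ^ j : ℤ) : ℝ) := by
      push_cast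
      field_simp
      ring
    rw [this, Int.floor_add_intCast]
    omega

lemma hdig_shift_mem (n : ℕ) (x : ℝ) :
    (x + 1 / 2 ^ (n + 1) ∈ Ico (0:ℝ) 1 ∧ hdig n (x + 1 / 2 ^ (n + 1)) = 1) ↔
      (x ∈ Ico (0:ℝ) 1 ∧ hdig n x = 0) := by
  have key : ∀ y : ℝ, y ∈ Ico (0:ℝ) 1 ↔ 0 ≤ ⌊2 ^ (n + 1) * y⌋ ∧ ⌊2 ^ (n + 1) * y⌋ < 2 * 2 ^ n := by
    intro y
    have hp : (0:ℝ) < 2 ^ (n + 1) := by positivity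
    rw [Int.floor_nonneg, Int.floor_lt]
    push_cast
    rw [← pow_succ', mem_Ico]
    constructor
    · rintro ⟨h1, h2⟩
      exact ⟨by positivity, by nlinarith⟩
    · rintro ⟨h1, h2⟩
      exact ⟨by by_contra hh; push Not at hh; nlinarith, by nlinarith⟩
  rw [key, key]
  unfold hdig
  rw [hdig_shift_self]
  omega

/-- Any large set in an interval contains two points differing in the `n`th digit only. -/
lemma hdig_flip (a d : ℝ) (hd : 0 < d) (n : ℕ) (A : Set ℝ) (hA : MeasurableSet A)
    (hAs : A ⊆ Ico a (a + d)) (hv : ENNReal.ofReal (d / 2) < volume A) :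
    ∃ x ∈ A, ∃ y ∈ A, hdig n ((x - a) / d) = 0 ∧ hdig n ((y - a) / d) = 1 ∧
      ∀ m, m ≠ n → hdig m ((y - a) / d) = hdig m ((x - a) / d) := by
  set h : ℝ := d / 2 ^ (n + 1) with hh
  have hsh : ∀ s : ℝ, (s + h - a) / d = (s - a) / d + 1 / 2 ^ (n + 1) := by
    intro s; rw [hh]; field_simp; ring
  have hIco : ∀ s : ℝ, s ∈ Ico a (a + d) ↔ (s - a) / d ∈ Ico (0:ℝ) 1 := by
    intro s
    rw [mem_Ico, mem_Ico, le_div_iff₀ hd, div_lt_iff₀ hd]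
    constructor <;> rintro ⟨h1, h2⟩ <;> constructor <;> linarith
  have hm : Measurable (fun s : ℝ => hdig n ((s - a) / d)) :=
    (hdig_measurable n).comp (by fun_prop)
  set D0 : Set ℝ := {s | hdig n ((s - a) / d) = 0} with hD0
  set D1 : Set ℝ := {s | hdig n ((s - a) / d) = 1} with hD1
  have mD0 : MeasurableSet D0 := hm (measurableSet_singleton 0)
  have mD1 : MeasurableSet D1 := hm (measurableSet_singleton 1)
  have hc : D0ᶜ = D1 := by
    ext s
    simp only [hD0, hD1, mem_compl_iff, mem_ofPred_eq]
    rcases hdig_eq n ((s - a) / d) with h | h <;> simp [h]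
  have hpre : (fun s => s + h) ⁻¹' (Ico a (a + d) ∩ D1) = Ico a (a + d) ∩ D0 := by
    ext s
    simp only [mem_preimage, mem_inter_iff, hD0, hD1, mem_ofPred_eq]
    rw [hIco, hIco, hsh]
    exact hdig_shift_mem n _
  have hJ : volume (Ico a (a + d) ∩ D1) = volume (Ico a (a + d) ∩ D0) := by
    rw [← hpre, measure_preimage_add_right]
  have htot : volume (Ico a (a + d) ∩ D0) + volume (Ico a (a + d) ∩ D0) = ENNReal.ofReal d := by
    have := measure_inter_add_sdiff (μ := volume) (Ico a (a + d)) mD0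
    rw [sdiff_eq, hc, hJ, Real.volume_Ico] at this
    rw [this]; congr 1; ring
  have hhalf : volume (Ico a (a + d) ∩ D0) = ENNReal.ofReal (d / 2) := by
    have hfin : volume (Ico a (a + d) ∩ D0) ≠ ⊤ := by
      intro hx; rw [hx] at htot; simp at htot
    rw [← ENNReal.ofReal_toReal hfin] at htot ⊢
    rw [← ENNReal.ofReal_add ENNReal.toReal_nonneg ENNReal.toReal_nonneg,
      ENNReal.ofReal_eq_ofReal_iff (by positivity) hd.le] at htot
    congr 1; linarith
  have hAv : volume (A ∩ D0) + volume ((fun s => s + h) ⁻¹' (A ∩ D1)) = volume A := by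
    rw [measure_preimage_add_right, ← hc, ← sdiff_eq]
    exact measure_inter_add_sdiff A mD0
  have hne : ¬ Disjoint (A ∩ D0) ((fun s => s + h) ⁻¹' (A ∩ D1)) := by
    intro hdis
    rw [← measure_union hdis ((measurable_id.add_const h) (hA.inter mD1))] at hAv
    have : volume (A ∩ D0 ∪ (fun s => s + h) ⁻¹' (A ∩ D1)) ≤ volume (Ico a (a + d) ∩ D0) := by
      apply measure_mono
      apply union_subset
      · exact inter_subset_inter_left _ hAs
      · rw [← hpre]
        exact preimage_mono (inter_subset_inter_left _ hAs)
    rw [hAv, hhalf] at this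
    exact absurd hv (not_lt.mpr this)
  rw [Set.not_disjoint_iff] at hne
  obtain ⟨x, hx0, hx1⟩ := hne
  refine ⟨x, hx0.1, x + h, hx1.1, hx0.2, hx1.2, fun m hmn => ?_⟩
  rw [hsh]
  exact hdig_shift_ne n m hmn _ hx0.2

lemma hdig_flip_bdd (a d : ℝ) (hd : 0 < d) (g : ℝ → ℝ) (P : ℝ → Prop)
    (hg : AEMeasurable g (volume.restrict (Ico a (a + d))))
    (hP : ∀ᵐ s ∂(volume.restrict (Ico a (a + d))), P s) :
    ∃ R : ℝ, ∀ n : ℕ, ∃ x y : ℝ, x ∈ Ico a (a + d) ∧ y ∈ Ico a (a + d) ∧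
      P x ∧ P y ∧ g x ≤ R ∧ g y ≤ R ∧
      hdig n ((x - a) / d) = 0 ∧ hdig n ((y - a) / d) = 1 ∧
      ∀ m, m ≠ n → hdig m ((y - a) / d) = hdig m ((x - a) / d) := by
  have hgood : ∀ᵐ s ∂(volume.restrict (Ico a (a + d))), P s ∧ g s = hg.mk g s :=
    hP.and hg.ae_eq_mk
  rw [ae_restrict_iff' measurableSet_Ico] at hgood
  obtain ⟨N, hNs, hNm, hN0⟩ := exists_measurable_superset_of_null (ae_iff.mp hgood)
  set A : ℕ → Set ℝ := fun k => (Ico a (a + d) ∩ {s | hg.mk g s ≤ k}) \ N with hAdef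
  have hmono : Monotone A := by
    intro i j hij s hs
    simp only [hAdef, Set.mem_sdiff, mem_inter_iff, mem_ofPred_eq] at hs ⊢
    refine ⟨⟨hs.1.1, le_trans hs.1.2 ?_⟩, hs.2⟩
    exact_mod_cast hij
  have hU : (⋃ k, A k) = Ico a (a + d) \ N := by
    ext s
    simp only [hAdef, mem_iUnion, Set.mem_sdiff, mem_inter_iff, mem_ofPred_eq]
    constructor
    · rintro ⟨k, hk⟩; exact ⟨hk.1.1, hk.2⟩
    · rintro ⟨h1, h2⟩
      obtain ⟨k, hk⟩ := exists_nat_ge (hg.mk g s)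
      exact ⟨k, ⟨h1, hk⟩, h2⟩
  have ht := tendsto_measure_iUnion_atTop (μ := volume) hmono
  rw [hU, measure_sdiff_null hN0, Real.volume_Ico] at ht
  have hlt : ENNReal.ofReal (d / 2) < ENNReal.ofReal (a + d - a) := by
    rw [ENNReal.ofReal_lt_ofReal_iff (by linarith)]; linarith
  obtain ⟨k, hk⟩ := (ht.eventually (lt_mem_nhds hlt)).exists
  refine ⟨k, fun n => ?_⟩
  have hAm : MeasurableSet (A k) :=
    (measurableSet_Ico.inter (hg.measurable_mk measurableSet_Iic)).diff hNm
  obtain ⟨x, hx, y, hy, h1, h2, h3⟩ := hdig_flip a d hd n (A k) hAm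
    (fun s hs => hs.1.1) hk
  have hout : ∀ s ∈ A k, P s ∧ g s ≤ k := by
    intro s hs
    have : ¬ (¬ (s ∈ Ico a (a + d) → P s ∧ g s = hg.mk g s)) := fun hc => hs.2 (hNs hc)
    have h4 := (not_not.mp this) hs.1.1
    exact ⟨h4.1, h4.2 ▸ hs.1.2⟩
  exact ⟨x, y, hx.1.1, hy.1.1, (hout x hx).1, (hout y hy).1, (hout x hx).2, (hout y hy).2,
    h1, h2, h3⟩

section Honesty

variable {E : Type*} [NormedAddCommGroup E] [NormedSpace ℝ E]

lemma honesty_B_sub (S : PerturbedSetting E) (t : ℝ) {u v : E} (hu : u ∈ S.DB t)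
    (hv : v ∈ S.DB t) : u - v ∈ S.DB t ∧ S.B t (u - v) = S.B t u - S.B t v := by
  have h1 : (-1 : ℝ) • v ∈ S.DB t := S.DB_smul t (-1) v hv
  have e : u - v = u + (-1 : ℝ) • v := by rw [neg_one_smul, sub_eq_add_neg]
  rw [e]
  refine ⟨S.DB_add t _ hu _ h1, ?_⟩
  rw [S.B_add t _ hu _ h1, S.B_smul t _ _ hv, neg_one_smul, sub_eq_add_neg]

lemma honesty_dom_Ioc (S : PerturbedSetting E) (u : E) {r : ℝ} (hr : 0 ≤ r) (T : ℝ) :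
    ∀ᵐ t ∂(volume.restrict (Ioc r T)), S.U t r u ∈ S.DB t :=
  ae_mono (Measure.restrict_mono (fun _ h => h.1.le) le_rfl) (S.BU_dom u r hr)

/-- The key claim, away from the initial time. -/
lemma honesty_claim_aux [CompleteSpace E] (S : PerturbedSetting E)
    (hH1dom : ∀ f : ℝ → E, Integrable f (volume.restrict (Set.Ioi (0:ℝ))) →
      ∀ᵐ p : ℝ × ℝ ∂(volume.restrict {p : ℝ × ℝ | 0 ≤ p.2 ∧ p.2 ≤ p.1}),
        S.U p.1 p.2 (f p.2) ∈ S.DB p.1)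
    (hH1meas : ∀ f : ℝ → E, Integrable f (volume.restrict (Set.Ioi (0:ℝ))) →
      AEStronglyMeasurable (fun p : ℝ × ℝ => S.B p.1 (S.U p.1 p.2 (f p.2)))
        (volume.restrict {p : ℝ × ℝ | 0 ≤ p.2 ∧ p.2 ≤ p.1}))
    (r : ℝ) (hr : 0 ≤ r) (d : ℝ) (hd : 0 < d) (u : ℕ → E) (hu : Summable fun n => ‖u n‖) :
    ∀ᵐ t ∂(volume.restrict (Ioi (r + d))),
      ∃ R : ℝ, ∀ n, ‖S.B t (S.U t r (u n))‖ ≤ R := by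
  classical
  set e : ℕ → ℝ → ℝ := fun n s => (hdig n ((s - r) / d) : ℝ) with he
  have he01 : ∀ n s, ‖e n s‖ ≤ 1 := by
    intro n s
    rcases hdig_eq n ((s - r) / d) with h | h <;> simp [he, h]
  have hem : ∀ n, Measurable (e n) := fun n =>
    (measurable_from_top (f := fun k : ℤ => (k : ℝ))).comp
      ((hdig_measurable n).comp (by fun_prop))
  have hsumm : ∀ s, Summable fun n => e n s • u n := by
    intro s
    refine Summable.of_norm_bounded hu (fun n => ?_)
    rw [norm_smul]
    exact mul_le_of_le_one_left (norm_nonneg _) (he01 n s)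
  set F : ℝ → E := fun s => ∑' n, e n s • u n with hF
  have hFb : ∀ s, ‖F s‖ ≤ ∑' n, ‖u n‖ := by
    intro s
    refine tsum_of_norm_bounded hu.hasSum (fun n => ?_)
    rw [norm_smul]
    exact mul_le_of_le_one_left (norm_nonneg _) (he01 n s)
  set f : ℝ → E := (Ico r (r + d)).indicator (fun s => S.U s r (F s)) with hf
  have hfint : Integrable f (volume.restrict (Ioi (0:ℝ))) := by
    apply Integrable.restrict
    rw [hf, integrable_indicator_iff measurableSet_Ico]
    obtain ⟨C, β, hC, hβ, hb⟩ := S.U_bound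
    have hmeas : AEStronglyMeasurable (fun s => S.U s r (F s))
        (volume.restrict (Ico r (r + d))) := by
      refine aestronglyMeasurable_of_tendsto_ae atTop
        (f := fun N s => ∑ n ∈ Finset.range N, e n s • S.U s r (u n)) ?_ ?_
      · intro N
        refine Finset.aestronglyMeasurable_fun_sum _ (fun n _ => ?_)
        refine AEStronglyMeasurable.smul (hem n).aestronglyMeasurable ?_
        refine ContinuousOn.aestronglyMeasurable ?_ measurableSet_Ico
        refine (S.U_cont (u n)).comp (f := fun s : ℝ => (s, r)) (by fun_prop) ?_
        intro s hs
        exact ⟨hr, hs.1⟩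
      · refine Eventually.of_forall (fun s => ?_)
        have := ((S.U s r).hasSum (hsumm s).hasSum).tendsto_sum_nat
        simpa using this
    refine IntegrableOn.of_bound (C := C * Real.exp (β * d) * ∑' n, ‖u n‖)
      (by rw [Real.volume_Ico]; exact ENNReal.ofReal_lt_top) hmeas ?_
    refine (ae_restrict_iff' measurableSet_Ico).mpr (Eventually.of_forall fun s hs => ?_)
    refine (ContinuousLinearMap.le_opNorm _ _).trans ?_
    refine mul_le_mul ((hb s r hr hs.1).trans ?_) (hFb s) (norm_nonneg _) (by positivity)
    have : s - r ≤ d := by linarith [hs.2]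
    gcongr
  have hsub : Ioi (r + d) ×ˢ Ico r (r + d) ⊆ {p : ℝ × ℝ | 0 ≤ p.2 ∧ p.2 ≤ p.1} := by
    rintro ⟨t, s⟩ ⟨h1, h2⟩
    exact ⟨hr.trans h2.1, (h2.2.trans h1).le⟩
  have hle : (volume.restrict (Ioi (r + d))).prod (volume.restrict (Ico r (r + d)))
      ≤ (volume : Measure (ℝ × ℝ)).restrict {p : ℝ × ℝ | 0 ≤ p.2 ∧ p.2 ≤ p.1} := by
    rw [Measure.prod_restrict]
    exact Measure.restrict_mono hsub le_rfl
  have h1 := Measure.ae_ae_of_ae_prod (ae_mono hle (hH1dom f hfint))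
  have h2 := ((hH1meas f hfint).mono_measure hle).prodMk_left
  have h3 : ∀ᵐ t ∂(volume.restrict (Ioi (r + d))), ∀ n, S.U t r (u n) ∈ S.DB t := by
    rw [ae_all_iff]
    intro n
    refine ae_mono (Measure.restrict_mono ?_ le_rfl) (S.BU_dom (u n) r hr)
    intro t ht
    have : r + d < t := ht
    exact (by linarith : r ≤ t)
  filter_upwards [h1, h2, h3, ae_restrict_mem measurableSet_Ioi] with t h1 h2 h3 ht
  have hUf : ∀ s ∈ Ico r (r + d), S.U t s (f s) = S.U t r (F s) := by
    intro s hs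
    rw [hf, indicator_of_mem hs]
    exact (S.U_comp t s r hr hs.1 (hs.2.trans ht).le _).symm
  obtain ⟨R, hR⟩ := hdig_flip_bdd r d hd (fun s => ‖S.B t (S.U t s (f s))‖)
    (fun s => S.U t s (f s) ∈ S.DB t) h2.norm.aemeasurable h1
  refine ⟨R + R, fun n => ?_⟩
  obtain ⟨x, y, hx, hy, Px, Py, gx, gy, hx0, hy1, hxy⟩ := hR n
  have hdiff : F y - F x = u n := by
    rw [hF]
    simp only
    rw [← (hsumm y).tsum_sub (hsumm x), tsum_eq_single n]
    · simp [he, hx0, hy1]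
    · intro m hm
      simp [he, hxy m hm]
  rw [hUf x hx] at Px
  rw [hUf y hy] at Py
  simp only [hUf x hx] at gx
  simp only [hUf y hy] at gy
  rw [← hdiff, map_sub, (honesty_B_sub S t Py Px).2]
  exact (norm_sub_le _ _).trans (add_le_add gy gx)

lemma honesty_claim [CompleteSpace E] (S : PerturbedSetting E)
    (hH1dom : ∀ f : ℝ → E, Integrable f (volume.restrict (Set.Ioi (0:ℝ))) →
      ∀ᵐ p : ℝ × ℝ ∂(volume.restrict {p : ℝ × ℝ | 0 ≤ p.2 ∧ p.2 ≤ p.1}),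
        S.U p.1 p.2 (f p.2) ∈ S.DB p.1)
    (hH1meas : ∀ f : ℝ → E, Integrable f (volume.restrict (Set.Ioi (0:ℝ))) →
      AEStronglyMeasurable (fun p : ℝ × ℝ => S.B p.1 (S.U p.1 p.2 (f p.2)))
        (volume.restrict {p : ℝ × ℝ | 0 ≤ p.2 ∧ p.2 ≤ p.1}))
    (r : ℝ) (hr : 0 ≤ r) (u : ℕ → E) (hu : Summable fun n => ‖u n‖) :
    ∀ᵐ t ∂(volume.restrict (Ioi r)),
      ∃ R : ℝ, ∀ n, ‖S.B t (S.U t r (u n))‖ ≤ R := by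
  have h : ∀ k : ℕ, ∀ᵐ t ∂volume, t ∈ Ioi (r + 1 / ((k : ℝ) + 1)) →
      ∃ R : ℝ, ∀ n, ‖S.B t (S.U t r (u n))‖ ≤ R := fun k =>
    (ae_restrict_iff' measurableSet_Ioi).mp
      (honesty_claim_aux S hH1dom hH1meas r hr (1 / ((k : ℝ) + 1)) (by positivity) u hu)
  rw [ae_restrict_iff' measurableSet_Ioi]
  filter_upwards [ae_all_iff.mpr h] with t ht htr
  obtain ⟨k, hk⟩ := exists_nat_one_div_lt (K := ℝ) (sub_pos.mpr (mem_Ioi.mp htr) : 0 < t - r)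
  exact ht k (by rw [mem_Ioi]; linarith)

lemma honesty_integrable (S : PerturbedSetting E) (u : E) {r T : ℝ} (hr : 0 ≤ r) (hT : r ≤ T) :
    IntegrableOn (fun t => S.B t (S.U t r u)) (Ioc r T) volume := by
  obtain ⟨v, w, hv, hw, rfl⟩ := S.generating u
  have h := (S.BU_integrable v hv r T hr hT).sub (S.BU_integrable w hw r T hr hT)
  refine Integrable.congr h ?_
  filter_upwards [honesty_dom_Ioc S v hr T, honesty_dom_Ioc S w hr T] with t h1 h2
  simp only [Pi.sub_apply]
  rw [map_sub, (honesty_B_sub S t h1 h2).2]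

/-- The seminorm `u ↦ ∫_r^T ‖B(t)U(t,r)u‖ dt`. -/
noncomputable def honestySeminorm (S : PerturbedSetting E) (r T : ℝ) (hr : 0 ≤ r) (hT : r ≤ T) :
    Seminorm ℝ E :=
  Seminorm.of (fun u => ∫ t in Ioc r T, ‖S.B t (S.U t r u)‖)
    (by
      intro u v
      have iu := honesty_integrable S u hr hT
      have iv := honesty_integrable S v hr hT
      rw [← integral_add iu.norm iv.norm]
      refine integral_mono_ae (honesty_integrable S (u + v) hr hT).norm (iu.norm.add iv.norm) ?_
      filter_upwards [honesty_dom_Ioc S u hr T, honesty_dom_Ioc S v hr T] with t h1 h2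
      rw [map_add, S.B_add t _ h1 _ h2]
      exact norm_add_le _ _)
    (by
      intro c u
      rw [← integral_const_mul]
      refine integral_congr_ae ?_
      filter_upwards [honesty_dom_Ioc S u hr T] with t h1
      rw [map_smul, S.B_smul t _ _ h1, norm_smul])

lemma honestySeminorm_apply (S : PerturbedSetting E) (r T : ℝ) (hr : 0 ≤ r) (hT : r ≤ T) (u : E) :
    honestySeminorm S r T hr hT u = ∫ t in Ioc r T, ‖S.B t (S.U t r u)‖ := rfl

lemma honestySeminorm_pos (S : PerturbedSetting E) (r T : ℝ) (hr : 0 ≤ r) (hT : r ≤ T) (u : E)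
    (hu : u ∈ S.pos) : honestySeminorm S r T hr hT u ≤ ‖u‖ := by
  have := S.BU_int u hu r T hr hT
  rw [intervalIntegral.integral_of_le hT] at this
  rw [honestySeminorm_apply]
  linarith [norm_nonneg (S.U T r u)]

lemma honestySeminorm_continuous [CompleteSpace E] (S : PerturbedSetting E)
    (hH1dom : ∀ f : ℝ → E, Integrable f (volume.restrict (Set.Ioi (0:ℝ))) →
      ∀ᵐ p : ℝ × ℝ ∂(volume.restrict {p : ℝ × ℝ | 0 ≤ p.2 ∧ p.2 ≤ p.1}),
        S.U p.1 p.2 (f p.2) ∈ S.DB p.1)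
    (hH1meas : ∀ f : ℝ → E, Integrable f (volume.restrict (Set.Ioi (0:ℝ))) →
      AEStronglyMeasurable (fun p : ℝ × ℝ => S.B p.1 (S.U p.1 p.2 (f p.2)))
        (volume.restrict {p : ℝ × ℝ | 0 ≤ p.2 ∧ p.2 ≤ p.1}))
    (r T : ℝ) (hr : 0 ≤ r) (hT : r ≤ T) : Continuous (honestySeminorm S r T hr hT) := by
  apply Seminorm.continuous_of_lowerSemicontinuous
  rw [lowerSemicontinuous_iff_isClosed_preimage]
  intro c
  apply IsSeqClosed.isClosed
  intro x u hx hxu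
  -- choose a rapidly converging subsequence
  have hsub : ∀ n : ℕ, ∃ k, ‖x k - u‖ < (1 / 4 : ℝ) ^ n := by
    intro n
    have := (tendsto_iff_norm_sub_tendsto_zero.mp hxu).eventually
      (gt_mem_nhds (show (0:ℝ) < (1 / 4) ^ n by positivity))
    exact this.exists
  choose k hk using hsub
  set y : ℕ → E := fun n => x (k n) with hy
  have hsum : Summable fun n => ‖(2 : ℝ) ^ n • (y n - u)‖ := by
    refine Summable.of_nonneg_of_le (fun n => norm_nonneg _) (fun n => ?_)
      (summable_geometric_of_lt_one (r := (1 / 2 : ℝ)) (by norm_num) (by norm_num))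
    rw [norm_smul, norm_pow, Real.norm_ofNat]
    calc (2:ℝ) ^ n * ‖y n - u‖ ≤ 2 ^ n * (1 / 4) ^ n := by gcongr; exact (hk n).le
      _ = (1 / 2) ^ n := by rw [← mul_pow]; norm_num
  have hcl := ae_mono (Measure.restrict_mono (fun t (ht : t ∈ Ioc r T) => mem_Ioi.mpr ht.1) le_rfl)
    (honesty_claim S hH1dom hH1meas r hr _ hsum)
  have hdy : ∀ᵐ t ∂(volume.restrict (Ioc r T)), ∀ n, S.U t r (y n) ∈ S.DB t :=
    ae_all_iff.mpr fun n => honesty_dom_Ioc S (y n) hr T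
  have hlim : ∀ᵐ t ∂(volume.restrict (Ioc r T)),
      Tendsto (fun n => S.B t (S.U t r (y n))) atTop (𝓝 (S.B t (S.U t r u))) := by
    filter_upwards [hcl, hdy, honesty_dom_Ioc S u hr T] with t ⟨R, hR⟩ hd hdu
    rw [tendsto_iff_norm_sub_tendsto_zero]
    have hz : Tendsto (fun n : ℕ => R * (1 / 2 : ℝ) ^ n) atTop (𝓝 0) := by
      have := (tendsto_pow_atTop_nhds_zero_of_lt_one (r := (1 / 2 : ℝ))
        (by norm_num) (by norm_num)).const_mul R
      simpa using this
    refine squeeze_zero (fun n => norm_nonneg _) (fun n => ?_) hz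
    have h1 := hR n
    have h2 := honesty_B_sub S t (hd n) hdu
    rw [map_smul, map_sub, S.B_smul t _ _ h2.1, h2.2, norm_smul, norm_pow, Real.norm_ofNat] at h1
    rw [one_div, inv_pow, ← div_eq_mul_inv, le_div_iff₀ (by positivity), mul_comm]
    exact h1
  have hF := Lp.eLpNorm_lim_le_liminf_eLpNorm (p := 1) (μ := volume.restrict (Ioc r T))
    (fun n => (honesty_integrable S (y n) hr hT).aestronglyMeasurable) _ hlim
  have hval : ∀ v : E, eLpNorm (fun t => S.B t (S.U t r v)) 1 (volume.restrict (Ioc r T))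
      = ENNReal.ofReal (honestySeminorm S r T hr hT v) := by
    intro v
    rw [eLpNorm_one_eq_lintegral_enorm, honestySeminorm_apply,
      ofReal_integral_norm_eq_lintegral_enorm (honesty_integrable S v hr hT)]
  simp only [hval] at hF
  have hxc : ∀ n, honestySeminorm S r T hr hT (x n) ≤ c := fun n => hx n
  have hc0 : 0 ≤ c := (apply_nonneg _ _).trans (hxc 0)
  have h2 : ENNReal.ofReal (honestySeminorm S r T hr hT u) ≤ ENNReal.ofReal c := by
    refine hF.trans ?_
    refine liminf_le_of_frequently_le' (Frequently.of_forall fun n => ?_)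
    exact ENNReal.ofReal_le_ofReal (hxc (k n))
  exact (ENNReal.ofReal_le_ofReal_iff hc0).mp h2

lemma honesty_lintegral (S : PerturbedSetting E) (u : E) (r : ℝ) (hr : 0 ≤ r) (c : ℝ)
    (h : ∀ T (hT : r ≤ T), honestySeminorm S r T hr hT u ≤ c) :
    ∫⁻ t in Ioi r, ‖S.B t (S.U t r u)‖ₑ ≤ ENNReal.ofReal c := by
  have hU : Ioi r = ⋃ k : ℕ, Ioc r (r + k) := by
    ext t
    simp only [mem_Ioi, mem_iUnion, mem_Ioc]
    constructor
    · intro ht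
      obtain ⟨k, hk⟩ := exists_nat_ge (t - r)
      exact ⟨k, ht, by linarith⟩
    · rintro ⟨k, hk⟩; exact hk.1
  have hmono : Monotone fun k : ℕ => Ioc r (r + k) := by
    intro i j hij
    have : (i : ℝ) ≤ j := by exact_mod_cast hij
    exact Ioc_subset_Ioc_right (by linarith)
  rw [hU, setLIntegral_iUnion_of_directed _ (directed_of_isDirected_le hmono)]
  refine iSup_le fun k => ?_
  have hT : r ≤ r + k := by simp
  rw [← ofReal_integral_norm_eq_lintegral_enorm (honesty_integrable S u hr hT)]
  exact ENNReal.ofReal_le_ofReal (h _ hT)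

lemma honesty_bound [CompleteSpace E] (S : PerturbedSetting E)
    (hH1dom : ∀ f : ℝ → E, Integrable f (volume.restrict (Set.Ioi (0:ℝ))) →
      ∀ᵐ p : ℝ × ℝ ∂(volume.restrict {p : ℝ × ℝ | 0 ≤ p.2 ∧ p.2 ≤ p.1}),
        S.U p.1 p.2 (f p.2) ∈ S.DB p.1)
    (hH1meas : ∀ f : ℝ → E, Integrable f (volume.restrict (Set.Ioi (0:ℝ))) →
      AEStronglyMeasurable (fun p : ℝ × ℝ => S.B p.1 (S.U p.1 p.2 (f p.2)))
        (volume.restrict {p : ℝ × ℝ | 0 ≤ p.2 ∧ p.2 ≤ p.1})) :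
    ∃ M : ℝ, 0 ≤ M ∧ ∀ (r : ℝ), 0 ≤ r → ∀ u : E,
      ∫⁻ t in Ioi r, ‖S.B t (S.U t r u)‖ₑ ≤ ENNReal.ofReal (M * ‖u‖) := by
  set p : {q : ℝ × ℝ // 0 ≤ q.1 ∧ q.1 ≤ q.2} → Seminorm ℝ E :=
    fun q => honestySeminorm S q.1.1 q.1.2 q.2.1 q.2.2 with hp
  have hbdd : BddAbove (range p) := by
    rw [Seminorm.bddAbove_range_iff]
    intro u
    obtain ⟨v, w, hv, hw, rfl⟩ := S.generating u
    refine ⟨‖v‖ + ‖w‖, ?_⟩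
    rintro _ ⟨q, rfl⟩
    refine (map_sub_le_add (p q) v w).trans (add_le_add ?_ ?_)
    · exact honestySeminorm_pos S _ _ _ _ v hv
    · exact honestySeminorm_pos S _ _ _ _ w hw
  have hcont : Continuous (⨆ q, p q : Seminorm ℝ E) :=
    by
      have := Seminorm.continuous_iSup p
        (fun q => honestySeminorm_continuous S hH1dom hH1meas _ _ _ _) hbdd
      simpa [Seminorm.coe_iSup_eq hbdd] using this
  obtain ⟨M, hM, hMb⟩ := Seminorm.bound_of_continuous_normedSpace _ hcont
  refine ⟨M, hM.le, fun r hr u => honesty_lintegral S u r hr _ fun T hT => ?_⟩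
  refine le_trans ?_ (hMb u)
  rw [Seminorm.iSup_apply hbdd]
  exact le_ciSup (f := fun q => p q u) ((Seminorm.bddAbove_range_iff.mp hbdd) u) ⟨(r, T), hr, hT⟩

lemma honesty_main [CompleteSpace E] (S : PerturbedSetting E)
    (hH1meas : ∀ f : ℝ → E, Integrable f (volume.restrict (Set.Ioi (0:ℝ))) →
      AEStronglyMeasurable (fun p : ℝ × ℝ => S.B p.1 (S.U p.1 p.2 (f p.2)))
        (volume.restrict {p : ℝ × ℝ | 0 ≤ p.2 ∧ p.2 ≤ p.1}))
    (l : ℝ) (hl : 0 < l) (K : ℝ) (hK : 0 ≤ K) (f : ℝ → E)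
    (hf : Integrable f (volume.restrict (Set.Ioi (0:ℝ))))
    (hb : ∀ᵐ s ∂(volume.restrict (Ioi (0:ℝ))),
      ∫⁻ t in Ioi s, ‖S.B t (S.U t s (f s))‖ₑ ≤ ENNReal.ofReal (K * ‖f s‖)) :
    Integrable
        (fun s => ∫ τ in (0:ℝ)..s, Real.exp (-(l * (s - τ))) • S.B s (S.U s τ (f τ)))
        (volume.restrict (Set.Ioi (0:ℝ))) ∧
      (∫ s in Set.Ioi (0:ℝ),
          ‖∫ τ in (0:ℝ)..s, Real.exp (-(l * (s - τ))) • S.B s (S.U s τ (f τ))‖)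
        ≤ K * ∫ s in Set.Ioi (0:ℝ), ‖f s‖ := by
  set μ : Measure ℝ := volume.restrict (Ioi (0:ℝ)) with hμ
  set D : Set (ℝ × ℝ) := {p : ℝ × ℝ | 0 ≤ p.2 ∧ p.2 ≤ p.1} with hD
  have hDm : MeasurableSet D :=
    (measurableSet_le measurable_const measurable_snd).inter
      (measurableSet_le measurable_snd measurable_fst)
  set H : ℝ × ℝ → E := D.indicator
    (fun p => Real.exp (-(l * (p.1 - p.2))) • S.B p.1 (S.U p.1 p.2 (f p.2))) with hH
  have hHm : AEStronglyMeasurable H (μ.prod μ) := by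
    have h1 : AEStronglyMeasurable H (volume : Measure (ℝ × ℝ)) := by
      rw [hH, aestronglyMeasurable_indicator_iff hDm]
      refine AEStronglyMeasurable.smul ?_ (hH1meas f hf)
      exact (by fun_prop : Continuous fun p : ℝ × ℝ =>
        Real.exp (-(l * (p.1 - p.2)))).aestronglyMeasurable
    rw [hμ, Measure.prod_restrict]
    exact h1.restrict
  have hHle : ∀ᵐ s ∂μ, ∫⁻ t, ‖H (t, s)‖ₑ ∂μ ≤ ENNReal.ofReal K * ‖f s‖ₑ := by
    filter_upwards [hb, ae_restrict_mem measurableSet_Ioi] with s hs hs0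
    have hs0' : (0:ℝ) < s := hs0
    rw [ENNReal.ofReal_mul hK, ofReal_norm] at hs
    refine le_trans ?_ hs
    rw [← setLIntegral_congr (Ioi_ae_eq_Ici (a := s) (μ := volume)).symm,
      ← lintegral_indicator measurableSet_Ici]
    refine le_trans (setLIntegral_le_lintegral _ _) (lintegral_mono fun t => ?_)
    by_cases ht : s ≤ t
    · have h1 : (t, s) ∈ D := ⟨hs0'.le, ht⟩
      rw [hH, indicator_of_mem h1, indicator_of_mem (show t ∈ Ici s from ht)]
      simp only
      rw [enorm_smul]
      refine mul_le_of_le_one_left zero_le ?_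
      rw [Real.enorm_eq_ofReal (Real.exp_pos _).le, ← ENNReal.ofReal_one]
      apply ENNReal.ofReal_le_ofReal
      rw [Real.exp_le_one_iff]
      have : 0 ≤ t - s := by linarith
      have := mul_nonneg hl.le this
      linarith
    · have h1 : (t, s) ∉ D := fun h => ht h.2
      rw [hH, indicator_of_notMem h1]
      simp
  have htot : ∫⁻ t, ∫⁻ s, ‖H (t, s)‖ₑ ∂μ ∂μ ≤ ENNReal.ofReal K * ∫⁻ s, ‖f s‖ₑ ∂μ := by
    rw [lintegral_lintegral_swap (f := fun t s => ‖H (t, s)‖ₑ) hHm.enorm,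
      ← lintegral_const_mul' _ _ ENNReal.ofReal_ne_top]
    exact lintegral_mono_ae hHle
  have hfin : ENNReal.ofReal K * ∫⁻ s, ‖f s‖ₑ ∂μ < ⊤ :=
    ENNReal.mul_lt_top ENNReal.ofReal_lt_top hf.2
  have hHint : Integrable H (μ.prod μ) := by
    refine ⟨hHm, ?_⟩
    rw [hasFiniteIntegral_iff_enorm, lintegral_prod _ hHm.enorm]
    exact htot.trans_lt hfin
  set G : ℝ → E := fun s => ∫ τ in (0:ℝ)..s, Real.exp (-(l * (s - τ))) • S.B s (S.U s τ (f τ))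
    with hG
  have hGH : (fun t => ∫ s, H (t, s) ∂μ) =ᵐ[μ] G := by
    filter_upwards [ae_restrict_mem measurableSet_Ioi] with t ht
    have ht0 : (0:ℝ) < t := ht
    rw [hG]
    simp only
    rw [intervalIntegral.integral_of_le ht0.le, ← integral_indicator measurableSet_Ioc, hμ,
      ← integral_indicator measurableSet_Ioi]
    congr 1
    ext s
    by_cases h0 : 0 < s
    · rw [indicator_of_mem (show s ∈ Ioi (0:ℝ) from h0)]
      by_cases hst : s ≤ t
      · rw [hH, indicator_of_mem (show (t, s) ∈ D from ⟨h0.le, hst⟩),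
          indicator_of_mem (show s ∈ Ioc 0 t from ⟨h0, hst⟩)]
      · rw [hH, indicator_of_notMem (show (t, s) ∉ D from fun h => hst h.2),
          indicator_of_notMem (show s ∉ Ioc 0 t from fun h => hst h.2)]
    · rw [indicator_of_notMem (show s ∉ Ioi (0:ℝ) from h0),
        indicator_of_notMem (show s ∉ Ioc 0 t from fun h => h0 h.1)]
  have hGint : Integrable G μ := hHint.integral_prod_left.congr hGH
  refine ⟨hGint, ?_⟩
  have hGl : ∫⁻ t, ‖G t‖ₑ ∂μ ≤ ENNReal.ofReal K * ∫⁻ s, ‖f s‖ₑ ∂μ := by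
    refine le_trans (lintegral_mono_ae ?_) htot
    filter_upwards [hGH] with t ht
    rw [← ht]
    exact enorm_integral_le_lintegral_enorm _
  have h0 : 0 ≤ ∫ s, ‖f s‖ ∂μ := integral_nonneg fun _ => norm_nonneg _
  rw [← ENNReal.ofReal_le_ofReal_iff (mul_nonneg hK h0), ENNReal.ofReal_mul hK,
    ofReal_integral_norm_eq_lintegral_enorm hGint, ofReal_integral_norm_eq_lintegral_enorm hf]
  exact hGl

end Honesty

theorem honesty_stmt4 {E : Type*} [NormedAddCommGroup E] [NormedSpace ℝ E]
    [CompleteSpace E] (S : PerturbedSetting E)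
    (hH1dom : ∀ f : ℝ → E, Integrable f (volume.restrict (Set.Ioi (0:ℝ))) →
      ∀ᵐ p : ℝ × ℝ ∂(volume.restrict {p : ℝ × ℝ | 0 ≤ p.2 ∧ p.2 ≤ p.1}),
        S.U p.1 p.2 (f p.2) ∈ S.DB p.1)
    (hH1meas : ∀ f : ℝ → E, Integrable f (volume.restrict (Set.Ioi (0:ℝ))) →
      AEStronglyMeasurable (fun p : ℝ × ℝ => S.B p.1 (S.U p.1 p.2 (f p.2)))
        (volume.restrict {p : ℝ × ℝ | 0 ≤ p.2 ∧ p.2 ≤ p.1}))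
    (l : ℝ) (hl : 0 < l)
    :
    (∀ f : ℝ → E, Integrable f (volume.restrict (Set.Ioi (0:ℝ))) →
      Integrable
        (fun s => ∫ τ in (0:ℝ)..s, Real.exp (-(l * (s - τ))) • S.B s (S.U s τ (f τ)))
        (volume.restrict (Set.Ioi (0:ℝ)))) ∧
    (∀ f : ℝ → E, Integrable f (volume.restrict (Set.Ioi (0:ℝ))) →
      (∀ᵐ s ∂(volume.restrict (Set.Ioi (0:ℝ))), f s ∈ S.pos) →
      (∫ s in Set.Ioi (0:ℝ),
          ‖∫ τ in (0:ℝ)..s, Real.exp (-(l * (s - τ))) • S.B s (S.U s τ (f τ))‖)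
        ≤ ∫ s in Set.Ioi (0:ℝ), ‖f s‖) ∧
    (∃ M : ℝ, 0 ≤ M ∧ ∀ f : ℝ → E, Integrable f (volume.restrict (Set.Ioi (0:ℝ))) →
      (∫ s in Set.Ioi (0:ℝ),
          ‖∫ τ in (0:ℝ)..s, Real.exp (-(l * (s - τ))) • S.B s (S.U s τ (f τ))‖)
        ≤ M * ∫ s in Set.Ioi (0:ℝ), ‖f s‖) := by
  obtain ⟨M, hM, hMb⟩ := honesty_bound S hH1dom hH1meas
  have hall := fun (f : ℝ → E) (hf : Integrable f (volume.restrict (Set.Ioi (0:ℝ)))) =>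
    honesty_main S hH1meas l hl M hM f hf (by
      filter_upwards [ae_restrict_mem measurableSet_Ioi] with s hs
      exact hMb s (le_of_lt hs) (f s))
  refine ⟨fun f hf => (hall f hf).1, fun f hf hpos => ?_, M, hM, fun f hf => (hall f hf).2⟩
  have := (honesty_main S hH1meas l hl 1 zero_le_one f hf (by
      filter_upwards [ae_restrict_mem measurableSet_Ioi, hpos] with s hs hp
      rw [one_mul]
      exact honesty_lintegral S (f s) s (le_of_lt hs) _
        (fun T hT => honestySeminorm_pos S s T _ hT (f s) hp))).2
  rwa [one_mul] at this
end

section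
/- Under Assumptions (H) and (H1), let (V(t,s))_{t≥s≥0} be the evolution family satisfying the Duhamel formula V(t,s)u = U(t,s)u + ∫_s^t V(t,r)B(r)U(r,s)u dr. Then for every f ∈ X and every λ > 0, for a.e. t ≥ 0: ∫₀^t e^{−λ(t−s)} V(t,s)f(s) ds = ∫₀^t e^{−λ(t−s)} U(t,s)f(s) ds + ∫₀^t e^{−λ(t−r)} V(t,r)[𝔅_λ f](r) dr, where [𝔅_λ f](r) = ∫₀^r e^{−λ(r−τ)} B(r)U(r,τ)f(τ) dτ. -/
open MeasureTheory Set Filter Topology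

theorem aux_right_meas {E : Type*} [NormedAddCommGroup E] (h : ℝ → E)
    (hr : ∀ r, h r ≠ 0 → ContinuousWithinAt h (Ioi r) r) : StronglyMeasurable h := by
  set G : Set ℝ := {r | h r ≠ 0} with hG
  have hright : ∀ r ∈ G, ∃ y, r < y ∧ Ioo r y ⊆ G := by
    intro r hrG
    have h1 : ∀ᶠ x in 𝓝[>] r, h x ≠ 0 := (hr r hrG).eventually_ne hrG
    obtain ⟨y, hy, hy2⟩ := (mem_nhdsGT_iff_exists_Ioo_subset).1 h1
    exact ⟨y, hy, hy2⟩
  have hGm : MeasurableSet G := by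
    have hc : (G \ interior G).Countable := by
      have : ∀ r, ∃ y, r ∈ G → r < y ∧ Ioo r y ⊆ G := by
        intro r
        by_cases hrG : r ∈ G
        · obtain ⟨y, hy⟩ := hright r hrG
          exact ⟨y, fun _ => hy⟩
        · exact ⟨0, fun hh => absurd hh hrG⟩
      choose y hy using this
      have hsub : ∀ r ∈ G, Ioo r (y r) ⊆ interior G := fun r hrG =>
        interior_maximal (hy r hrG).2 isOpen_Ioo
      have key : ∀ a ∈ G \ interior G, ∀ b ∈ G \ interior G, a < b →
          Disjoint (Ioo a (y a)) (Ioo b (y b)) := by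
        intro a ha b hb hab
        rw [Set.disjoint_left]
        intro x hx hx'
        exact hb.2 (hsub a ha.1 ⟨hab, hx'.1.trans hx.2⟩)
      refine Set.PairwiseDisjoint.countable_of_Ioo (y := y) ?_ (fun x hx => (hy x hx.1).1)
      intro a ha b hb hab
      rcases lt_or_gt_of_ne hab with h1 | h1
      · exact key a ha b hb h1
      · exact (key b hb a ha h1).symm
    have : G = interior G ∪ (G \ interior G) := by
      rw [Set.union_sdiff_cancel interior_subset]
    rw [this]
    exact isOpen_interior.measurableSet.union hc.measurableSet
  have hf : ∀ n : ℕ, StronglyMeasurable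
      (fun r : ℝ => G.indicator (fun r => h (((⌊((n:ℝ)+1) * r⌋ : ℝ) + 1) / ((n:ℝ)+1))) r) := by
    intro n
    refine StronglyMeasurable.indicator ?_ hGm
    have h1 : StronglyMeasurable (fun k : ℤ => h (((k:ℝ) + 1) / ((n:ℝ)+1))) :=
      StronglyMeasurable.of_discrete
    exact h1.comp_measurable (g := fun r : ℝ => ⌊((n:ℝ)+1) * r⌋)
      (Int.measurable_floor.comp (measurable_const.mul measurable_id))
  refine stronglyMeasurable_of_tendsto atTop hf ?_
  rw [tendsto_pi_nhds]
  intro r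
  by_cases hrG : r ∈ G
  · simp only [Set.indicator_of_mem hrG]
    refine (hr r hrG).tendsto.comp ?_
    rw [tendsto_nhdsWithin_iff]
    have hlow : ∀ n : ℕ, r < ((⌊((n:ℝ)+1) * r⌋ : ℝ) + 1) / ((n:ℝ)+1) := by
      intro n
      rw [lt_div_iff₀ (by positivity), mul_comm]
      exact Int.lt_floor_add_one _
    refine ⟨?_, Eventually.of_forall hlow⟩
    have h2 : Tendsto (fun n : ℕ => r + 1 / ((n:ℝ)+1)) atTop (𝓝 (r + 0)) :=
      tendsto_const_nhds.add tendsto_one_div_add_atTop_nhds_zero_nat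
    rw [add_zero] at h2
    refine tendsto_of_tendsto_of_tendsto_of_le_of_le tendsto_const_nhds h2
      (fun n => (hlow n).le) ?_
    intro n
    have hn : (0:ℝ) < (n:ℝ) + 1 := by positivity
    have := Int.floor_le (((n:ℝ)+1) * r)
    show ((⌊((n:ℝ)+1) * r⌋ : ℝ) + 1) / ((n:ℝ)+1) ≤ r + 1 / ((n:ℝ)+1)
    rw [div_le_iff₀ hn]
    have h5 : (r + 1 / ((n:ℝ)+1)) * ((n:ℝ)+1) = ((n:ℝ)+1) * r + 1 := by
      field_simp
    rw [h5]
    linarith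
  · have h0 : h r = 0 := by
      by_contra hne
      exact hrG hne
    simp only [Set.indicator_of_notMem hrG, h0]
    exact tendsto_const_nhds

theorem aux_apply_meas {Ω E : Type*} [NormedAddCommGroup E] [NormedSpace ℝ E]
    [MeasurableSpace Ω] {μ : Measure Ω} (φ : Ω → E →L[ℝ] E)
    (hφ : ∀ w, AEStronglyMeasurable (fun x => φ x w) μ) (g : Ω → E)
    (hg : AEStronglyMeasurable g μ) : AEStronglyMeasurable (fun x => φ x (g x)) μ := by
  have hs : ∀ s : SimpleFunc Ω E, AEStronglyMeasurable (fun x => φ x (s x)) μ := by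
    intro s
    have : (fun x => φ x (s x)) =
        fun x => ∑ w ∈ s.range, (s ⁻¹' {w}).indicator (fun x => φ x w) x := by
      funext x
      rw [Finset.sum_eq_single (s x)]
      · simp
      · intro b _ hb
        rw [Set.indicator_of_notMem]
        simpa using hb.symm
      · intro hx
        exact absurd (s.mem_range_self x) hx
    rw [this]
    exact Finset.aestronglyMeasurable_fun_sum _
      (fun w _ => (hφ w).indicator (s.measurableSet_fiber w))
  have h1 : AEStronglyMeasurable (fun x => φ x (hg.mk g x)) μ :=
    aestronglyMeasurable_of_tendsto_ae atTop
      (fun n => hs (hg.stronglyMeasurable_mk.approx n))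
      (Eventually.of_forall fun x => ((φ x).continuous.tendsto _).comp
        (hg.stronglyMeasurable_mk.tendsto_approx x))
  refine h1.congr ?_
  filter_upwards [hg.ae_eq_mk] with x hx
  rw [hx]

section
variable {E : Type*} [NormedAddCommGroup E] [NormedSpace ℝ E]

theorem aux_dom (S : PerturbedSetting E) (u : E) (s t : ℝ) (hs : 0 ≤ s) :
    ∀ᵐ r ∂(volume.restrict (Ioc s t)), S.U r s u ∈ S.DB r :=
  ae_mono (Measure.restrict_mono (show Ioc s t ⊆ Ici s from fun x hx => le_of_lt hx.1) le_rfl)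
    (S.BU_dom u s hs)

theorem aux_BU_sub (S : PerturbedSetting E) (u v : E) (s t : ℝ) (hs : 0 ≤ s) :
    ∀ᵐ r ∂(volume.restrict (Ioc s t)),
      S.B r (S.U r s (u - v)) = S.B r (S.U r s u) - S.B r (S.U r s v) := by
  filter_upwards [aux_dom S u s t hs, aux_dom S v s t hs] with r hu hv
  have h1 : S.U r s (u - v) = S.U r s u + (-1:ℝ) • S.U r s v := by
    rw [map_sub]; simp [sub_eq_add_neg]
  rw [h1, S.B_add r _ hu _ (S.DB_smul r _ _ hv), S.B_smul r _ _ hv]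
  simp [sub_eq_add_neg]

theorem aux_BU_int (S : PerturbedSetting E) (γ : ℝ)
    (hdecomp : ∀ u : E, ∃ v w : E, v ∈ S.pos ∧ w ∈ S.pos ∧ u = v - w ∧
      ‖v‖ ≤ γ * ‖u‖ ∧ ‖w‖ ≤ γ * ‖u‖) (u : E) (s t : ℝ) (hs : 0 ≤ s) (hst : s ≤ t) :
    IntegrableOn (fun r => S.B r (S.U r s u)) (Ioc s t) volume ∧
      ∫ r in Ioc s t, ‖S.B r (S.U r s u)‖ ≤ 2 * γ * ‖u‖ := by
  obtain ⟨v, w, hv, hw, rfl, hv2, hw2⟩ := hdecomp u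
  have hiv := S.BU_integrable v hv s t hs hst
  have hiw := S.BU_integrable w hw s t hs hst
  have hi : IntegrableOn (fun r => S.B r (S.U r s (v - w))) (Ioc s t) volume := by
    refine (hiv.sub hiw).congr ?_
    filter_upwards [aux_BU_sub S v w s t hs] with r hr
    exact hr.symm
  refine ⟨hi, ?_⟩
  have b1 := S.BU_int v hv s t hs hst
  have b2 := S.BU_int w hw s t hs hst
  rw [intervalIntegral.integral_of_le hst] at b1 b2
  have n1 := norm_nonneg (S.U t s v)
  have n2 := norm_nonneg (S.U t s w)
  have h3 : ∫ r in Ioc s t, ‖S.B r (S.U r s (v - w))‖ ≤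
      ∫ r in Ioc s t, (‖S.B r (S.U r s v)‖ + ‖S.B r (S.U r s w)‖) := by
    refine integral_mono_ae hi.norm (hiv.norm.add hiw.norm) ?_
    filter_upwards [aux_BU_sub S v w s t hs] with r hr
    simp only [hr]
    exact norm_sub_le _ _
  rw [integral_add hiv.norm hiw.norm] at h3
  linarith

variable [CompleteSpace E]

/-- Either the Duhamel integrand is integrable for every vector, or `V t s = U t s`. -/
theorem aux_dich (S : PerturbedSetting E) (V : ℝ → ℝ → E →L[ℝ] E)
    (hDuhamel : ∀ t s : ℝ, 0 ≤ s → s ≤ t → ∀ u : E,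
      V t s u = S.U t s u + ∫ r in s..t, V t r (S.B r (S.U r s u)))
    (t s : ℝ) (hs : 0 ≤ s) (hst : s ≤ t) (w : E) (hw : V t s w - S.U t s w ≠ 0) (u : E) :
    IntervalIntegrable (fun r => V t r (S.B r (S.U r s u))) volume s t := by
  by_contra hu
  have key : ∀ x : E, ¬ IntervalIntegrable (fun r => V t r (S.B r (S.U r s x))) volume s t →
      V t s x = S.U t s x := by
    intro x hx
    rw [hDuhamel t s hs hst x, intervalIntegral.integral_undef hx, add_zero]
  by_cases hwi : IntervalIntegrable (fun r => V t r (S.B r (S.U r s w))) volume s t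
  · have h1 : ¬ IntervalIntegrable (fun r => V t r (S.B r (S.U r s (w - u)))) volume s t := by
      intro h2
      apply hu
      rw [intervalIntegrable_iff_integrableOn_Ioc_of_le hst] at *
      refine (hwi.sub h2).congr ?_
      filter_upwards [aux_BU_sub S w u s t hs] with r hr
      simp only [Pi.sub_apply]
      rw [hr, map_sub, sub_sub_cancel]
    have e1 := key _ h1
    have e2 := key _ hu
    rw [map_sub, map_sub, e2] at e1
    exact hw (sub_eq_zero.2 (sub_left_injective e1))
  · exact hw (sub_eq_zero.2 (key w hwi))

theorem aux_rightcont (S : PerturbedSetting E) (γ : ℝ) (V : ℝ → ℝ → E →L[ℝ] E)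
    (hVbound : ∀ t s : ℝ, 0 ≤ s → s ≤ t → ∀ u : E, ‖V t s u‖ ≤ 2 * γ * ‖u‖)
    (hDuhamel : ∀ t s : ℝ, 0 ≤ s → s ≤ t → ∀ u : E,
      V t s u = S.U t s u + ∫ r in s..t, V t r (S.B r (S.U r s u)))
    (t s : ℝ) (hs : 0 ≤ s) (hst : s < t) (w : E) (hw : V t s w - S.U t s w ≠ 0) :
    Tendsto (fun r => V t r w - S.U t r w) (𝓝[>] s) (𝓝 (V t s w - S.U t s w)) := by
  have hI := aux_dich S V hDuhamel t s hs hst.le w hw w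
  have hev : ∀ᶠ r in 𝓝[>] s, s < r ∧ r < t :=
    (eventually_mem_nhdsWithin (s := Ioi s)).and (eventually_nhdsWithin_of_eventually_nhds
      (eventually_lt_nhds hst))
  -- convergence of the primitive
  have hprim : Tendsto (fun r => ∫ x in s..r, V t x (S.B x (S.U x s w))) (𝓝[>] s) (𝓝 0) := by
    have h1 := intervalIntegral.continuousOn_primitive_interval' hI left_mem_uIcc s left_mem_uIcc
    rw [uIcc_of_le hst.le] at h1
    have h2 := h1.tendsto
    simp only [intervalIntegral.integral_same] at h2
    refine h2.mono_left ?_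
    refine nhdsWithin_le_of_mem ?_
    filter_upwards [hev] with r hr
    exact ⟨hr.1.le, hr.2.le⟩
  have hmapU : Tendsto (fun r : ℝ => ((r, s) : ℝ × ℝ)) (𝓝[>] s)
      (𝓝[{p : ℝ × ℝ | 0 ≤ p.2 ∧ p.2 ≤ p.1}] (s, s)) := by
    rw [tendsto_nhdsWithin_iff]
    refine ⟨?_, ?_⟩
    · exact ((continuous_id.prodMk continuous_const).tendsto' s _ rfl).mono_left nhdsWithin_le_nhds
    · filter_upwards [hev] with r hr
      exact ⟨hs, hr.1.le⟩
  have hU1 : Tendsto (fun r => S.U r s w - w) (𝓝[>] s) (𝓝 0) := by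
    have := (S.U_cont w (s, s) ⟨hs, le_rfl⟩).tendsto.comp hmapU
    simp only [S.U_id s hs w] at this
    have h2 := this.sub_const w
    rw [sub_self] at h2
    exact h2
  have hmapU2 : Tendsto (fun r : ℝ => ((t, r) : ℝ × ℝ)) (𝓝[>] s)
      (𝓝[{p : ℝ × ℝ | 0 ≤ p.2 ∧ p.2 ≤ p.1}] (t, s)) := by
    rw [tendsto_nhdsWithin_iff]
    refine ⟨?_, ?_⟩
    · exact ((continuous_const.prodMk continuous_id).tendsto' s _ rfl).mono_left nhdsWithin_le_nhds
    · filter_upwards [hev] with r hr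
      exact ⟨hs.trans hr.1.le, hr.2.le⟩
  have hU2 : Tendsto (fun r => S.U t r w) (𝓝[>] s) (𝓝 (S.U t s w)) :=
    (S.U_cont w (t, s) ⟨hs, hst.le⟩).tendsto.comp hmapU2
  have hVU : Tendsto (fun r => V t r (S.U r s w - w)) (𝓝[>] s) (𝓝 0) := by
    refine squeeze_zero_norm' (a := fun r => 2 * γ * ‖S.U r s w - w‖) ?_ ?_
    · filter_upwards [hev] with r hr
      exact hVbound t r (hs.trans hr.1.le) hr.2.le _
    · have := hU1.norm.const_mul (2 * γ)
      simpa using this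
  have hfin : Tendsto (fun r => V t s w - (∫ x in s..r, V t x (S.B x (S.U x s w)))
      - V t r (S.U r s w - w) - S.U t r w) (𝓝[>] s) (𝓝 (V t s w - 0 - 0 - S.U t s w)) :=
    ((tendsto_const_nhds.sub hprim).sub hVU).sub hU2
  rw [sub_zero, sub_zero] at hfin
  refine hfin.congr' ?_
  filter_upwards [hev] with r hr
  have e1 := hDuhamel t s hs hst.le w
  have e2 := hDuhamel t r (hs.trans hr.1.le) hr.2.le (S.U r s w)
  rw [← S.U_comp t r s hs hr.1.le hr.2.le] at e2
  have e3 : ∫ x in r..t, V t x (S.B x (S.U x r (S.U r s w))) =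
      ∫ x in r..t, V t x (S.B x (S.U x s w)) := by
    refine intervalIntegral.integral_congr ?_
    intro x hx
    rw [uIcc_of_le hr.2.le] at hx
    show V t x (S.B x (S.U x r (S.U r s w))) = V t x (S.B x (S.U x s w))
    rw [← S.U_comp x r s hs hr.1.le hx.1]
  have hr' : r ∈ uIcc s t := by
    rw [uIcc_of_le hst.le]; exact ⟨hr.1.le, hr.2.le⟩
  have e4 := intervalIntegral.integral_add_adjacent_intervals
    (hI.mono_set (uIcc_subset_uIcc left_mem_uIcc hr'))
    (hI.mono_set (uIcc_subset_uIcc hr' right_mem_uIcc))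
  rw [map_sub, e2, e3, e1, ← e4]
  abel

theorem aux_U_meas (S : PerturbedSetting E) (t : ℝ) (w : E) :
    AEStronglyMeasurable (fun r => S.U t r w) (volume.restrict (Ioc 0 t)) := by
  refine ContinuousOn.aestronglyMeasurable ?_ measurableSet_Ioc
  refine (S.U_cont w).comp (f := fun r : ℝ => ((t, r) : ℝ × ℝ))
    (continuous_const.prodMk continuous_id).continuousOn ?_
  intro r hr
  exact ⟨hr.1.le, hr.2⟩

theorem aux_V_meas (S : PerturbedSetting E) (γ : ℝ) (V : ℝ → ℝ → E →L[ℝ] E)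
    (hVbound : ∀ t s : ℝ, 0 ≤ s → s ≤ t → ∀ u : E, ‖V t s u‖ ≤ 2 * γ * ‖u‖)
    (hDuhamel : ∀ t s : ℝ, 0 ≤ s → s ≤ t → ∀ u : E,
      V t s u = S.U t s u + ∫ r in s..t, V t r (S.B r (S.U r s u)))
    (t : ℝ) (w : E) :
    AEStronglyMeasurable (fun r => V t r w) (volume.restrict (Ioc 0 t)) := by
  have hm : StronglyMeasurable ((Ico 0 t).indicator (fun r => V t r w - S.U t r w)) := by
    refine aux_right_meas _ ?_
    intro s hs0
    have hs : s ∈ Ico 0 t := by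
      by_contra h
      exact hs0 (Set.indicator_of_notMem h _)
    rw [Set.indicator_of_mem hs] at hs0
    have := aux_rightcont S γ V hVbound hDuhamel t s hs.1 hs.2 w hs0
    unfold ContinuousWithinAt
    rw [Set.indicator_of_mem hs]
    refine this.congr' ?_
    filter_upwards [Ioo_mem_nhdsGT hs.2] with r hr
    rw [Set.indicator_of_mem]
    exact ⟨hs.1.trans hr.1.le, hr.2⟩
  refine (hm.aestronglyMeasurable.add (aux_U_meas S t w)).congr ?_
  filter_upwards [ae_restrict_mem measurableSet_Ioc] with r hr
  rcases hr.2.lt_or_eq with h | h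
  · simp [Set.indicator_of_mem (show r ∈ Ico 0 t from ⟨hr.1.le, h⟩)]
  · subst h
    have := hDuhamel r r hr.1.le le_rfl w
    simp at this
    simp [this]
end

theorem honesty_stmt5 {E : Type*} [NormedAddCommGroup E] [NormedSpace ℝ E]
    [CompleteSpace E] (S : PerturbedSetting E)
    (γ : ℝ) (hγ : 0 < γ)
    (hdecomp : ∀ u : E, ∃ v w : E, v ∈ S.pos ∧ w ∈ S.pos ∧ u = v - w ∧
      ‖v‖ ≤ γ * ‖u‖ ∧ ‖w‖ ≤ γ * ‖u‖)
    (hH1dom : ∀ f : ℝ → E, Integrable f (volume.restrict (Set.Ioi (0:ℝ))) →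
      ∀ᵐ p : ℝ × ℝ ∂(volume.restrict {p : ℝ × ℝ | 0 ≤ p.2 ∧ p.2 ≤ p.1}),
        S.U p.1 p.2 (f p.2) ∈ S.DB p.1)
    (hH1meas : ∀ f : ℝ → E, Integrable f (volume.restrict (Set.Ioi (0:ℝ))) →
      AEStronglyMeasurable (fun p : ℝ × ℝ => S.B p.1 (S.U p.1 p.2 (f p.2)))
        (volume.restrict {p : ℝ × ℝ | 0 ≤ p.2 ∧ p.2 ≤ p.1}))
    (V : ℝ → ℝ → E →L[ℝ] E)
    (hVpos : ∀ t s : ℝ, 0 ≤ s → s ≤ t → ∀ u ∈ S.pos, V t s u ∈ S.pos)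
    (hVcontr : ∀ t s : ℝ, 0 ≤ s → s ≤ t → ∀ u ∈ S.pos, ‖V t s u‖ ≤ ‖u‖)
    (hVbound : ∀ t s : ℝ, 0 ≤ s → s ≤ t → ∀ u : E, ‖V t s u‖ ≤ 2 * γ * ‖u‖)
    (hDuhamel : ∀ t s : ℝ, 0 ≤ s → s ≤ t → ∀ u : E,
      V t s u = S.U t s u + ∫ r in s..t, V t r (S.B r (S.U r s u)))
    :
    ∀ f : ℝ → E, Integrable f (volume.restrict (Set.Ioi (0:ℝ))) → ∀ l : ℝ, 0 < l →
      ∀ᵐ t ∂(volume.restrict (Set.Ioi (0:ℝ))),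
        (∫ s in (0:ℝ)..t, Real.exp (-(l * (t - s))) • V t s (f s))
          = (∫ s in (0:ℝ)..t, Real.exp (-(l * (t - s))) • S.U t s (f s))
            + ∫ r in (0:ℝ)..t, Real.exp (-(l * (t - r))) •
                V t r (∫ τ in (0:ℝ)..r, Real.exp (-(l * (r - τ))) • S.B r (S.U r τ (f τ))) := by
  intro f hf l hl
  filter_upwards [ae_restrict_mem measurableSet_Ioi] with t ht0
  have ht : (0:ℝ) < t := ht0
  set μ : Measure ℝ := volume.restrict (Ioc 0 t) with hμ
  have hmem : ∀ᵐ s ∂μ, s ∈ Ioc 0 t := ae_restrict_mem measurableSet_Ioc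
  have hfμ : Integrable f μ :=
    hf.mono_measure (Measure.restrict_mono (fun x hx => hx.1) le_rfl)
  have hVm := aux_V_meas S γ V hVbound hDuhamel t
  have hUm := aux_U_meas S t
  have hexpm : ∀ a : ℝ, AEStronglyMeasurable (fun s : ℝ => Real.exp (-(l * (a - s)))) μ := by
    intro a
    exact (by fun_prop : Continuous fun s : ℝ => Real.exp (-(l * (a - s)))).aestronglyMeasurable
  set D : Set (ℝ × ℝ) := {p | p.2 < p.1} with hD
  have hDm : MeasurableSet D := measurableSet_lt measurable_snd measurable_fst
  set K : ℝ × ℝ → E := D.indicator (fun p => S.B p.1 (S.U p.1 p.2 (f p.2))) with hKdef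
  have hμμ : μ.prod μ = volume.restrict (Ioc 0 t ×ˢ Ioc 0 t) := by
    rw [hμ, Measure.prod_restrict, Measure.volume_eq_prod]
  have hKm : AEStronglyMeasurable K (μ.prod μ) := by
    rw [hKdef, aestronglyMeasurable_indicator_iff hDm, hμμ, Measure.restrict_restrict hDm]
    refine (hH1meas f hf).mono_measure (Measure.restrict_mono ?_ le_rfl)
    rintro p ⟨hp1, hp2⟩
    exact ⟨hp2.2.1.le, le_of_lt hp1⟩
  have hIs : ∀ s ∈ Ioc 0 t, Ioi s ∩ Ioc 0 t = Ioc s t := by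
    intro s hs
    ext x
    simp only [mem_inter_iff, mem_Ioi, mem_Ioc]
    exact ⟨fun h => ⟨h.1, h.2.2⟩, fun h => ⟨h.1, hs.1.trans h.1, h.2⟩⟩
  have hKs : ∀ s, (fun r => K (r, s)) = (Ioi s).indicator (fun r => S.B r (S.U r s (f s))) := by
    intro s
    funext r
    by_cases h : s < r
    · rw [Set.indicator_of_mem (show r ∈ Ioi s from h), hKdef,
        Set.indicator_of_mem (show (r, s) ∈ D from h)]
    · rw [Set.indicator_of_notMem (show r ∉ Ioi s from h), hKdef,
        Set.indicator_of_notMem (show (r, s) ∉ D from h)]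
  have hKint : Integrable K (μ.prod μ) := by
    rw [integrable_prod_iff' hKm]
    constructor
    · filter_upwards [hmem] with s hs
      rw [hKs, integrable_indicator_iff measurableSet_Ioi, IntegrableOn, hμ,
        Measure.restrict_restrict measurableSet_Ioi, hIs s hs]
      exact (aux_BU_int S γ hdecomp (f s) s t hs.1.le hs.2).1
    · refine Integrable.mono' (hfμ.norm.const_mul (2 * γ)) ?_ ?_
      · exact hKm.norm.prod_swap.integral_prod_right'
      · filter_upwards [hmem] with s hs
        rw [Real.norm_of_nonneg (integral_nonneg fun _ => norm_nonneg _)]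
        have h1 : (fun r => ‖K (r, s)‖) =
            (Ioi s).indicator (fun r => ‖S.B r (S.U r s (f s))‖) := by
          funext r
          rw [show K (r, s) = _ from congrFun (hKs s) r, norm_indicator_eq_indicator_norm]
        rw [h1, integral_indicator measurableSet_Ioi, hμ,
          Measure.restrict_restrict measurableSet_Ioi, hIs s hs]
        exact (aux_BU_int S γ hdecomp (f s) s t hs.1.le hs.2).2
  set F : ℝ → ℝ → E := fun r s => Real.exp (-(l * (t - s))) • V t r (K (r, s)) with hF
  have hFint : Integrable (Function.uncurry F) (μ.prod μ) := by
    refine Integrable.mono' (hKint.norm.const_mul (2 * γ)) ?_ ?_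
    · refine AEStronglyMeasurable.smul (f := fun p : ℝ × ℝ => Real.exp (-(l * (t - p.2))))
        (g := fun p : ℝ × ℝ => V t p.1 (K p)) ?_ ?_
      · exact (hexpm t).comp_snd
      · exact aux_apply_meas (fun p : ℝ × ℝ => V t p.1) (fun w => (hVm w).comp_fst) K hKm
    · rw [hμμ]
      filter_upwards [ae_restrict_mem (measurableSet_Ioc.prod measurableSet_Ioc)] with p hp
      show ‖Real.exp (-(l * (t - p.2))) • V t p.1 (K p)‖ ≤ 2 * γ * ‖K p‖
      rw [norm_smul, Real.norm_of_nonneg (Real.exp_pos _).le]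
      have h1 : Real.exp (-(l * (t - p.2))) ≤ 1 := by
        rw [Real.exp_le_one_iff]
        have := mul_nonneg hl.le (sub_nonneg.2 hp.2.2)
        linarith
      exact (mul_le_of_le_one_left (norm_nonneg _) h1).trans
        (hVbound t p.1 hp.1.1.le hp.1.2 _)
  have hUint : Integrable (fun s => Real.exp (-(l * (t - s))) • S.U t s (f s)) μ := by
    obtain ⟨C, β, hC, hβ, hb⟩ := S.U_bound
    refine Integrable.mono' (hfμ.norm.const_mul (C * Real.exp (β * t))) ?_ ?_
    · exact (hexpm t).smul (aux_apply_meas (fun s => S.U t s) hUm f hfμ.1)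
    · filter_upwards [hmem] with s hs
      rw [norm_smul, Real.norm_of_nonneg (Real.exp_pos _).le]
      have h1 : Real.exp (-(l * (t - s))) ≤ 1 := by
        rw [Real.exp_le_one_iff]
        have := mul_nonneg hl.le (sub_nonneg.2 hs.2)
        linarith
      refine (mul_le_of_le_one_left (norm_nonneg _) h1).trans
        (((S.U t s).le_opNorm _).trans ?_)
      refine mul_le_mul_of_nonneg_right ((hb t s hs.1.le hs.2).trans ?_) (norm_nonneg _)
      refine mul_le_mul_of_nonneg_left (Real.exp_le_exp.2 ?_) hC.le
      have := mul_pos hβ hs.1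
      nlinarith
  have hduh : ∀ᵐ s ∂μ, Real.exp (-(l * (t - s))) • V t s (f s) =
      Real.exp (-(l * (t - s))) • S.U t s (f s) + ∫ r, F r s ∂μ := by
    filter_upwards [hmem] with s hs
    have h1 : ∫ r in s..t, V t r (S.B r (S.U r s (f s))) = ∫ r, V t r (K (r, s)) ∂μ := by
      have h2 : (fun r => V t r (K (r, s))) =
          (Ioi s).indicator (fun r => V t r (S.B r (S.U r s (f s)))) := by
        funext r
        rw [show K (r, s) = _ from congrFun (hKs s) r]
        by_cases h : r ∈ Ioi s
        · rw [Set.indicator_of_mem h, Set.indicator_of_mem h]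
        · rw [Set.indicator_of_notMem h, Set.indicator_of_notMem h, map_zero]
      rw [h2, integral_indicator measurableSet_Ioi, hμ,
        Measure.restrict_restrict measurableSet_Ioi, hIs s hs,
        intervalIntegral.integral_of_le hs.2]
    rw [hDuhamel t s hs.1.le hs.2, h1, smul_add, hF]
    simp only [integral_smul]
  simp only [intervalIntegral.integral_of_le ht.le]
  have hFi : Integrable (fun s => ∫ r, F r s ∂μ) μ := hFint.swap.integral_prod_left
  rw [← hμ, integral_congr_ae hduh, integral_add hUint hFi,
    ← integral_integral_swap hFint]
  congr 1
  refine integral_congr_ae ?_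
  filter_upwards [hmem, hKint.prod_right_ae] with r hr hKr
  have hint : Integrable (fun s => Real.exp (-(l * (r - s))) • K (r, s)) μ := by
    refine Integrable.mono' (hKr.norm) ((hexpm r).smul hKr.1) ?_
    filter_upwards with s
    rw [norm_smul, Real.norm_of_nonneg (Real.exp_pos _).le]
    by_cases h : s < r
    · refine mul_le_of_le_one_left (norm_nonneg _) ?_
      rw [Real.exp_le_one_iff]
      have := mul_nonneg hl.le (sub_nonneg.2 h.le)
      linarith
    · rw [hKdef, Set.indicator_of_notMem (show (r, s) ∉ D from h)]
      simp
  have h3 : ∫ τ in (0:ℝ)..r, Real.exp (-(l * (r - τ))) • S.B r (S.U r τ (f τ)) =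
      ∫ s, Real.exp (-(l * (r - s))) • K (r, s) ∂μ := by
    have h4 : (fun s => Real.exp (-(l * (r - s))) • K (r, s)) =
        (Iio r).indicator (fun s => Real.exp (-(l * (r - s))) • S.B r (S.U r s (f s))) := by
      funext s
      by_cases h : s < r
      · rw [Set.indicator_of_mem (show s ∈ Iio r from h), hKdef,
          Set.indicator_of_mem (show (r, s) ∈ D from h)]
      · rw [Set.indicator_of_notMem (show s ∉ Iio r from h), hKdef,
          Set.indicator_of_notMem (show (r, s) ∉ D from h), smul_zero]
    have h5 : Iio r ∩ Ioc 0 t = Ioo 0 r := by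
      ext x
      simp only [mem_inter_iff, mem_Iio, mem_Ioc, mem_Ioo]
      exact ⟨fun h => ⟨h.2.1, h.1⟩, fun h => ⟨h.2, h.1, h.2.le.trans hr.2⟩⟩
    rw [h4, integral_indicator measurableSet_Iio, hμ,
      Measure.restrict_restrict measurableSet_Iio, h5,
      intervalIntegral.integral_of_le hr.1.le, integral_Ioc_eq_integral_Ioo]
  rw [h3, ← ContinuousLinearMap.integral_comp_comm _ hint, ← integral_smul]
  refine integral_congr_ae (Eventually.of_forall fun s => ?_)
  show Real.exp (-(l * (t - s))) • V t r (K (r, s)) =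
    Real.exp (-(l * (t - r))) • V t r (Real.exp (-(l * (r - s))) • K (r, s))
  rw [map_smul, smul_smul, ← Real.exp_add]
  congr 2
  ring
end

section
/- Under Assumptions (H), (H1) and (HB), for every τ > 0 and every f ∈ X = L¹(ℝ₊,E), for almost every s > τ the element ∫₀^τ U(s,r)f(r) dr belongs to D(B(s)) and B(s)U(s,τ)∫₀^τ U(τ,r)f(r) dr = B(s)∫₀^τ U(s,r)f(r) dr = ∫₀^τ B(s)U(s,r)f(r) dr. -/
open MeasureTheory Set Filter Topology

open scoped ENNReal NNReal

section helpers

variable {E : Type*} [NormedAddCommGroup E] [NormedSpace ℝ E]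

/-- Increasing closedness of the operators `B t`. -/
def IncClosed (S : PerturbedSetting E) : Prop :=
  ∀ t : ℝ, ∀ c : ℕ → E, ∀ u : E,
      (∀ n, c n ∈ S.DB t) → (∀ n, c n ∈ S.pos) → (∀ n, c (n+1) - c n ∈ S.pos) →
      u ∈ S.pos → Filter.Tendsto c Filter.atTop (nhds u) →
      (∃ M : ℝ, ∀ n, ‖S.B t (c n)‖ ≤ M) →
      u ∈ S.DB t ∧ Filter.Tendsto (fun n => S.B t (c n)) Filter.atTop (nhds (S.B t u))

lemma B_sub (S : PerturbedSetting E) (t : ℝ) {u v : E} (hu : u ∈ S.DB t) (hv : v ∈ S.DB t) :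
    S.B t (u - v) = S.B t u - S.B t v := by
  have h := S.B_add t u hu ((-1 : ℝ) • v) (S.DB_smul t _ v hv)
  rw [S.B_smul t _ v hv] at h
  simpa [sub_eq_add_neg] using h

lemma B_zero (S : PerturbedSetting E) (t : ℝ) : S.B t 0 = 0 := by
  have h := S.B_smul t 0 0 (S.DB_zero t)
  simpa using h

lemma DB_sum (S : PerturbedSetting E) (t : ℝ) (v : ℕ → E) (h : ∀ k, v k ∈ S.DB t) (n : ℕ) :
    (∑ k ∈ Finset.range n, v k) ∈ S.DB t ∧
    S.B t (∑ k ∈ Finset.range n, v k) = ∑ k ∈ Finset.range n, S.B t (v k) := by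
  induction n with
  | zero => simpa using ⟨S.DB_zero t, B_zero S t⟩
  | succ n ih =>
    rw [Finset.sum_range_succ, Finset.sum_range_succ]
    exact ⟨S.DB_add t _ ih.1 _ (h n), by rw [S.B_add t _ ih.1 _ (h n), ih.2]⟩

lemma pos_sum (S : PerturbedSetting E) (v : ℕ → E) (h : ∀ k, v k ∈ S.pos) (n : ℕ) :
    (∑ k ∈ Finset.range n, v k) ∈ S.pos := by
  induction n with
  | zero => simpa using S.zero_mem
  | succ n ih =>
    rw [Finset.sum_range_succ]
    exact S.add_mem _ _ ih (h n)

lemma dom_ae (S : PerturbedSetting E) {τ : ℝ} (hτ : 0 ≤ τ) (u : E) :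
    ∀ᵐ s ∂(volume.restrict (Ioi τ)), S.U s τ u ∈ S.DB s :=
  ae_mono (Measure.restrict_mono Ioi_subset_Ici_self le_rfl) (S.BU_dom u τ hτ)

lemma meas_T (S : PerturbedSetting E) {τ : ℝ} (hτ : 0 ≤ τ) (u : E) :
    AEStronglyMeasurable (fun s => S.B s (S.U s τ u)) (volume.restrict (Ioi τ)) :=
  (S.BU_meas u τ hτ).mono_measure (Measure.restrict_mono Ioi_subset_Ici_self le_rfl)

lemma lint_pos (S : PerturbedSetting E) {τ : ℝ} (hτ : 0 ≤ τ) {u : E} (hu : u ∈ S.pos) :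
    ∫⁻ s in Ioi τ, ‖S.B s (S.U s τ u)‖ₑ ≤ ‖u‖ₑ := by
  have hb : Tendsto (fun n : ℕ => τ + (n : ℝ)) atTop atTop :=
    tendsto_atTop_add_const_left _ _ tendsto_natCast_atTop_atTop
  have hle : ∀ n : ℕ, (∫ s in τ..(τ + (n:ℝ)), ‖S.B s (S.U s τ u)‖) ≤ ‖u‖ := fun n =>
    (S.BU_int u hu τ _ hτ (by simp)).trans (by simp)
  have hi : IntegrableOn (fun s => S.B s (S.U s τ u)) (Ioi τ) volume :=
    integrableOn_Ioi_of_intervalIntegral_norm_bounded ‖u‖ τ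
      (fun n : ℕ => S.BU_integrable u hu τ _ hτ (by simp)) hb (Eventually.of_forall hle)
  have h2 : ∫ s in Ioi τ, ‖S.B s (S.U s τ u)‖ ≤ ‖u‖ :=
    le_of_tendsto' (intervalIntegral_tendsto_integral_Ioi τ hi.norm hb) hle
  rw [← ofReal_integral_norm_eq_lintegral_enorm hi, ← ofReal_norm]
  exact ENNReal.ofReal_le_ofReal h2

lemma lint_seq (S : PerturbedSetting E) (hHB : IncClosed S) {τ : ℝ} (hτ : 0 ≤ τ)
    (v : ℕ → E) (hv : ∀ k, v k ∈ S.pos) (hs : ∑' k, ‖v k‖ₑ ≠ ∞) {x : E} (hx : HasSum v x) :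
    ∫⁻ s in Ioi τ, ‖S.B s (S.U s τ x)‖ₑ ≤ ∑' k, ‖v k‖ₑ := by
  obtain ⟨p, m, hp, hm, rfl⟩ := S.generating x
  have hI : ∫⁻ s in Ioi τ, ∑' k, ‖S.B s (S.U s τ (v k))‖ₑ ≤ ∑' k, ‖v k‖ₑ := by
    rw [lintegral_tsum (fun k => (meas_T S hτ (v k)).enorm)]
    exact ENNReal.tsum_le_tsum fun k => lint_pos S hτ (hv k)
  have hfin : ∀ᵐ s ∂(volume.restrict (Ioi τ)), ∑' k, ‖S.B s (S.U s τ (v k))‖ₑ < ∞ :=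
    ae_lt_top' (AEMeasurable.tsum fun k => (meas_T S hτ (v k)).enorm)
      (ne_top_of_le_ne_top hs hI)
  refine le_trans (lintegral_mono_ae ?_) hI
  have hdv : ∀ᵐ s ∂(volume.restrict (Ioi τ)), ∀ k, S.U s τ (v k) ∈ S.DB s :=
    ae_all_iff.2 fun k => dom_ae S hτ (v k)
  filter_upwards [hfin, hdv, dom_ae S hτ p, dom_ae S hτ m, ae_restrict_mem measurableSet_Ioi]
    with s hs1 hdk hdp hdm hsτ
  have hsτ' : τ ≤ s := le_of_lt hsτ
  have hsum : Summable fun k => ‖S.B s (S.U s τ (v k))‖ :=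
    tsum_enorm_ne_top_iff_summable_norm.1 hs1.ne
  have hUp : ∀ u ∈ S.pos, S.U s τ u ∈ S.pos := S.U_pos s τ hτ hsτ'
  set w : ℕ → E := fun k => S.U s τ (v k) with hw
  have hB : ∀ n, S.B s (S.U s τ m + ∑ k ∈ Finset.range n, w k)
      = S.B s (S.U s τ m) + ∑ k ∈ Finset.range n, S.B s (w k) := fun n => by
    rw [S.B_add s _ hdm _ (DB_sum S s w hdk n).1, (DB_sum S s w hdk n).2]
  have key := hHB s (fun n => S.U s τ m + ∑ k ∈ Finset.range n, w k) (S.U s τ p)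
    (fun n => S.DB_add s _ hdm _ (DB_sum S s w hdk n).1)
    (fun n => S.add_mem _ _ (hUp m hm) (pos_sum S w (fun k => hUp _ (hv k)) n))
    (fun n => by
      have : S.U s τ m + ∑ k ∈ Finset.range (n+1), w k
        - (S.U s τ m + ∑ k ∈ Finset.range n, w k) = w n := by
        rw [Finset.sum_range_succ]; abel
      simp only [this]; exact hUp _ (hv n))
    (hUp p hp)
    (by
      have h1 : Tendsto (fun n => m + ∑ k ∈ Finset.range n, v k) atTop (𝓝 (m + (p - m))) :=
        tendsto_const_nhds.add hx.tendsto_sum_nat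
      have h2 := ((S.U s τ).continuous.tendsto _).comp h1
      simpa [Function.comp_def, map_sum, map_add] using h2)
    ⟨‖S.B s (S.U s τ m)‖ + ∑' k, ‖S.B s (w k)‖, fun n => by
      rw [hB n]
      refine (norm_add_le _ _).trans (add_le_add_right ((norm_sum_le _ _).trans ?_) _)
      exact hsum.sum_le_tsum _ (fun _ _ => norm_nonneg _)⟩
  have h3 : Tendsto (fun n => ∑ k ∈ Finset.range n, S.B s (w k)) atTop
      (𝓝 (S.B s (S.U s τ (p - m)))) := by
    rw [map_sub, B_sub S s hdp hdm]
    have := key.2.sub_const (S.B s (S.U s τ m))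
    simpa [hB] using this
  refine le_of_tendsto' h3.enorm fun n => ?_
  exact (enorm_sum_le _ _).trans (ENNReal.sum_le_tsum _)

lemma lint_fam (S : PerturbedSetting E) (hHB : IncClosed S) {τ : ℝ} (hτ : 0 ≤ τ)
    {ι : Type*} (v : ι → E) (hv : ∀ k, v k ∈ S.pos) (hs : ∑' k, ‖v k‖ₑ ≠ ∞)
    {x : E} (hx : HasSum v x) :
    ∫⁻ s in Ioi τ, ‖S.B s (S.U s τ x)‖ₑ ≤ ∑' k, ‖v k‖ₑ := by
  have hc : (Function.support v).Countable := by
    have := (tsum_enorm_ne_top_iff_summable_norm.1 hs).countable_support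
    simpa [Function.support] using this
  have := hc.toEncodable
  set e : Function.support v → ℕ := Encodable.encode with he
  have hinj : Function.Injective e := Encodable.encode_injective
  set w : ℕ → E := Function.extend e (fun i => v i) 0 with hw
  have hwe : (fun n => ‖w n‖ₑ) = Function.extend e (fun i => ‖v i‖ₑ) 0 := by
    funext n
    by_cases h : ∃ i, e i = n
    · obtain ⟨i, rfl⟩ := h
      rw [hw, hinj.extend_apply, hinj.extend_apply]
    · rw [hw, Function.extend_apply' _ _ _ h, Function.extend_apply' _ _ _ h]; simp
  have hsum : ∑' n, ‖w n‖ₑ = ∑' k, ‖v k‖ₑ := by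
    rw [hwe, tsum_extend_zero hinj]
    exact tsum_subtype_eq_of_support_subset (f := fun k => ‖v k‖ₑ) (by
      intro k hk; simpa using hk)
  rw [← hsum]
  refine lint_seq S hHB hτ w ?_ (by rwa [hsum]) ?_
  · intro n
    by_cases h : ∃ i, e i = n
    · obtain ⟨i, rfl⟩ := h
      rw [hw, hinj.extend_apply]; exact hv _
    · rw [hw, Function.extend_apply' _ _ _ h]; exact S.zero_mem
  · rw [hw, hasSum_extend_zero hinj]
    exact (hasSum_subtype_support).2 hx

lemma lint_sub (S : PerturbedSetting E) {τ : ℝ} (hτ : 0 ≤ τ) (x y : E) :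
    ∫⁻ s in Ioi τ, ‖S.B s (S.U s τ (x - y))‖ₑ ≤
      (∫⁻ s in Ioi τ, ‖S.B s (S.U s τ x)‖ₑ) + ∫⁻ s in Ioi τ, ‖S.B s (S.U s τ y)‖ₑ := by
  rw [← lintegral_add_left' (meas_T S hτ x).enorm]
  refine lintegral_mono_ae ?_
  filter_upwards [dom_ae S hτ x, dom_ae S hτ y] with s h1 h2
  rw [map_sub, B_sub S s h1 h2]
  exact enorm_sub_le

variable [CompleteSpace E]

/-- Bounded (closed-cone) decomposition through the open mapping theorem on `ℓ¹`. -/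
lemma decomp (S : PerturbedSetting E) : ∃ C : ℝ, 0 < C ∧ ∀ u : E,
    ∃ c : {v : E // v ∈ S.pos ∧ ‖v‖ ≤ 1} → ℝ, HasSum (fun i => c i • (i : E)) u ∧
      Summable (fun i => ‖c i‖) ∧ ∑' i, ‖c i‖ ≤ C * ‖u‖ := by
  classical
  set ι := {v : E // v ∈ S.pos ∧ ‖v‖ ≤ 1}
  have hn : ∀ c : lp (fun _ : ι => ℝ) 1, HasSum (fun i => ‖c i‖) ‖c‖ := fun c => by
    simpa using lp.hasSum_norm (p := 1) (by simp) c
  have hle : ∀ (c : lp (fun _ : ι => ℝ) 1) (i : ι), ‖c i • (i : E)‖ ≤ ‖c i‖ := fun c i => by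
    rw [norm_smul]; exact mul_le_of_le_one_right (norm_nonneg _) i.2.2
  have hsn : ∀ c : lp (fun _ : ι => ℝ) 1, Summable (fun i => c i • (i : E)) := fun c =>
    Summable.of_norm_bounded (hn c).summable (hle c)
  let L : lp (fun _ : ι => ℝ) 1 →ₗ[ℝ] E :=
    { toFun := fun c => ∑' i, c i • (i : E)
      map_add' := fun c d => by
        rw [← (hsn c).tsum_add (hsn d)]
        simp [add_smul]
      map_smul' := fun a c => by
        rw [RingHom.id_apply, ← (hsn c).tsum_const_smul]
        simp [mul_smul] }
  let Lc : lp (fun _ : ι => ℝ) 1 →L[ℝ] E := L.mkContinuous 1 (fun c => by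
    rw [one_mul]
    exact tsum_of_norm_bounded (hn c) (hle c))
  have hpos : ∀ v ∈ S.pos, ∃ c, Lc c = v := by
    intro v hv
    by_cases h0 : v = 0
    · exact ⟨0, by simp [h0]⟩
    have hne : ‖v‖ ≠ 0 := norm_ne_zero_iff.2 h0
    let i : ι := ⟨‖v‖⁻¹ • v, S.smul_mem _ (by positivity) v hv, by
      rw [norm_smul, norm_inv, norm_norm, inv_mul_cancel₀ hne]⟩
    refine ⟨lp.single 1 i ‖v‖, ?_⟩
    change ∑' j, (lp.single (E := fun _ : ι => ℝ) 1 i ‖v‖) j • (j : E) = v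
    rw [tsum_eq_single i]
    · rw [lp.single_apply_self]
      change ‖v‖ • ‖v‖⁻¹ • v = v
      rw [smul_smul, mul_inv_cancel₀ hne, one_smul]
    · intro j hj
      rw [lp.single_apply_ne _ _ _ hj, zero_smul]
  have hsurj : Function.Surjective Lc := by
    intro u
    obtain ⟨v, w, hv, hw, rfl⟩ := S.generating u
    obtain ⟨c, rfl⟩ := hpos v hv
    obtain ⟨d, rfl⟩ := hpos w hw
    exact ⟨c - d, map_sub _ _ _⟩
  obtain ⟨C, hC, h⟩ := Lc.exists_preimage_norm_le hsurj
  refine ⟨C, hC, fun u => ?_⟩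
  obtain ⟨c, hc, hcn⟩ := h u
  refine ⟨c, ?_, (hn c).summable, by rwa [(hn c).tsum_eq]⟩
  rw [← hc]
  exact (hsn c).hasSum

lemma lint_bound (S : PerturbedSetting E) (hHB : IncClosed S) {τ : ℝ} (hτ : 0 ≤ τ) :
    ∃ C : ℝ, 0 < C ∧ ∀ u : E,
      ∫⁻ s in Ioi τ, ‖S.B s (S.U s τ u)‖ₑ ≤ ENNReal.ofReal (C * ‖u‖) := by
  obtain ⟨C, hC, h⟩ := decomp S
  refine ⟨C + C, by positivity, fun u => ?_⟩
  obtain ⟨c, hc, hs, hb⟩ := h u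
  have aux : ∀ d : {v : E // v ∈ S.pos ∧ ‖v‖ ≤ 1} → ℝ, (∀ i, 0 ≤ d i) → (∀ i, d i ≤ ‖c i‖) →
      Summable (fun i => d i • (i : E)) ∧
      ∫⁻ s in Ioi τ, ‖S.B s (S.U s τ (∑' i, d i • (i : E)))‖ₑ ≤ ENNReal.ofReal (C * ‖u‖) := by
    intro d h0 hd
    have hle : ∀ i, ‖d i • (i : E)‖ ≤ ‖c i‖ := fun i => by
      rw [norm_smul, Real.norm_of_nonneg (h0 i)]
      exact (mul_le_of_le_one_right (h0 i) i.2.2).trans (hd i)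
    have hsd : Summable (fun i => d i • (i : E)) := Summable.of_norm_bounded hs hle
    have hsn : Summable (fun i => ‖d i • (i : E)‖) :=
      Summable.of_nonneg_of_le (fun _ => norm_nonneg _) hle hs
    refine ⟨hsd, (lint_fam S hHB hτ _ (fun i => S.smul_mem _ (h0 i) _ i.2.1)
      (tsum_enorm_ne_top_iff_summable_norm.2 hsn) hsd.hasSum).trans ?_⟩
    calc ∑' i, ‖d i • (i : E)‖ₑ ≤ ∑' i, ENNReal.ofReal ‖c i‖ := by
          refine ENNReal.tsum_le_tsum fun i => ?_
          rw [← ofReal_norm]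
          exact ENNReal.ofReal_le_ofReal (hle i)
      _ = ENNReal.ofReal (∑' i, ‖c i‖) :=
          (ENNReal.ofReal_tsum_of_nonneg (fun _ => norm_nonneg _) hs).symm
      _ ≤ _ := ENNReal.ofReal_le_ofReal hb
  obtain ⟨s1, b1⟩ := aux (fun i => max (c i) 0) (fun i => le_max_right _ _)
    (fun i => max_le (le_abs_self _) (norm_nonneg _))
  obtain ⟨s2, b2⟩ := aux (fun i => max (-c i) 0) (fun i => le_max_right _ _)
    (fun i => max_le (neg_le_abs _) (norm_nonneg _))
  have hu : u = (∑' i, max (c i) 0 • (i : E)) - ∑' i, max (-c i) 0 • (i : E) := by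
    rw [← s1.tsum_sub s2, ← hc.tsum_eq]
    refine tsum_congr fun i => ?_
    rw [← sub_smul]
    congr 1
    rcases le_total 0 (c i) with h | h
    · rw [max_eq_left h, max_eq_right (by linarith)]; ring
    · rw [max_eq_right h, max_eq_left (by linarith)]; ring
  rw [add_mul, ENNReal.ofReal_add (by positivity) (by positivity)]
  calc _ ≤ _ := by
        conv_lhs => rw [hu]
        exact lint_sub S hτ _ _
    _ ≤ _ := add_le_add b1 b2

lemma int_T (S : PerturbedSetting E) (hHB : IncClosed S) {τ : ℝ} (hτ : 0 ≤ τ) (u : E) :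
    Integrable (fun s => S.B s (S.U s τ u)) (volume.restrict (Ioi τ)) := by
  obtain ⟨C, hC, h⟩ := lint_bound S hHB hτ
  exact ⟨meas_T S hτ u, (h u).trans_lt ENNReal.ofReal_lt_top⟩

lemma norm_int_T (S : PerturbedSetting E) (hHB : IncClosed S) {τ : ℝ} (hτ : 0 ≤ τ) :
    ∃ C : ℝ, 0 < C ∧ ∀ u : E, ∫ s in Ioi τ, ‖S.B s (S.U s τ u)‖ ≤ C * ‖u‖ := by
  obtain ⟨C, hC, h⟩ := lint_bound S hHB hτ
  refine ⟨C, hC, fun u => ?_⟩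
  have h1 := h u
  rw [← ofReal_integral_norm_eq_lintegral_enorm (int_T S hHB hτ u)] at h1
  exact (ENNReal.ofReal_le_ofReal_iff (by positivity)).1 h1

lemma clm_A (S : PerturbedSetting E) (hHB : IncClosed S) {τ : ℝ} (hτ : 0 ≤ τ) (A : Set ℝ) :
    ∃ L : E →L[ℝ] E, ∀ u, L u = ∫ s in A, S.B s (S.U s τ u) ∂(volume.restrict (Ioi τ)) := by
  obtain ⟨C, hC, h⟩ := norm_int_T S hHB hτ
  refine ⟨LinearMap.mkContinuous
    { toFun := fun u => ∫ s in A, S.B s (S.U s τ u) ∂(volume.restrict (Ioi τ))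
      map_add' := fun u v => ?_
      map_smul' := fun a u => ?_ } C (fun u => ?_), fun u => rfl⟩
  · rw [← integral_add (int_T S hHB hτ u).integrableOn (int_T S hHB hτ v).integrableOn]
    refine integral_congr_ae (ae_restrict_of_ae ?_)
    filter_upwards [dom_ae S hτ u, dom_ae S hτ v] with s h1 h2
    rw [map_add, S.B_add s _ h1 _ h2]
  · rw [RingHom.id_apply, ← integral_smul]
    refine integral_congr_ae (ae_restrict_of_ae ?_)
    filter_upwards [dom_ae S hτ u] with s h1
    rw [map_smul, S.B_smul s _ _ h1]
  · refine (norm_integral_le_integral_norm _).trans (le_trans ?_ (h u))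
    exact setIntegral_le_integral (int_T S hHB hτ u).norm
      (Eventually.of_forall fun _ => norm_nonneg _)


lemma int_g (S : PerturbedSetting E) {τ : ℝ} (hτ : 0 < τ) (f : ℝ → E)
    (hf : Integrable f (volume.restrict (Ioi (0:ℝ)))) :
    Integrable (fun r => S.U τ r (f r)) (volume.restrict (Ioc 0 τ)) := by
  obtain ⟨C, β, hC, hβ, hb⟩ := S.U_bound
  have hf' : Integrable f (volume.restrict (Ioc 0 τ)) :=
    hf.mono_measure (Measure.restrict_mono Ioc_subset_Ioi_self le_rfl)
  have hK : ∀ r ∈ Icc 0 τ, ‖S.U τ r‖ ≤ C * Real.exp (β * τ) := fun r hr =>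
    (hb τ r hr.1 hr.2).trans (by
      gcongr
      linarith [hr.1])
  let P : ℝ → ℝ := fun r => (projIcc 0 τ hτ.le r : ℝ)
  have hP : ∀ r, P r ∈ Icc 0 τ := fun r => (projIcc 0 τ hτ.le r).2
  have hcont : Continuous (fun p : ℝ × E => S.U τ (P p.1) p.2) := by
    refine continuous_prod_of_continuous_lipschitzWith' _ (C * Real.exp (β * τ)).toNNReal ?_ ?_
    · intro r
      refine (S.U τ (P r)).lipschitz.weaken ?_
      rw [← NNReal.coe_le_coe, Real.coe_toNNReal _ (by positivity)]
      exact hK _ (hP r)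
    · intro u
      refine (S.U_cont u).comp_continuous (f := fun r => (τ, P r)) ?_ fun r => hP r
      exact continuous_const.prodMk (continuous_subtype_val.comp continuous_projIcc)
  have hm : AEStronglyMeasurable (fun r => S.U τ (P r) (f r)) (volume.restrict (Ioc 0 τ)) :=
    hcont.comp_aestronglyMeasurable (aestronglyMeasurable_id.prodMk hf'.aestronglyMeasurable)
  have heq : ∀ᵐ r ∂(volume.restrict (Ioc 0 τ)), S.U τ (P r) (f r) = S.U τ r (f r) := by
    filter_upwards [ae_restrict_mem measurableSet_Ioc] with r hr
    have : P r = r := by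
      simp only [P]; rw [projIcc_of_mem hτ.le ⟨hr.1.le, hr.2⟩]
    rw [this]
  refine Integrable.mono' (hf'.norm.const_mul (C * Real.exp (β * τ))) (hm.congr heq) ?_
  filter_upwards [ae_restrict_mem measurableSet_Ioc] with r hr
  exact (S.U τ r).le_of_opNorm_le (hK r ⟨hr.1.le, hr.2⟩) _

end helpers

theorem honesty_stmt6 {E : Type*} [NormedAddCommGroup E] [NormedSpace ℝ E]
    [CompleteSpace E] (S : PerturbedSetting E)
    (hH1dom : ∀ f : ℝ → E, Integrable f (volume.restrict (Set.Ioi (0:ℝ))) →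
      ∀ᵐ p : ℝ × ℝ ∂(volume.restrict {p : ℝ × ℝ | 0 ≤ p.2 ∧ p.2 ≤ p.1}),
        S.U p.1 p.2 (f p.2) ∈ S.DB p.1)
    (hH1meas : ∀ f : ℝ → E, Integrable f (volume.restrict (Set.Ioi (0:ℝ))) →
      AEStronglyMeasurable (fun p : ℝ × ℝ => S.B p.1 (S.U p.1 p.2 (f p.2)))
        (volume.restrict {p : ℝ × ℝ | 0 ≤ p.2 ∧ p.2 ≤ p.1}))
    (hHB : ∀ t : ℝ, ∀ c : ℕ → E, ∀ u : E,
      (∀ n, c n ∈ S.DB t) → (∀ n, c n ∈ S.pos) → (∀ n, c (n+1) - c n ∈ S.pos) →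
      u ∈ S.pos → Filter.Tendsto c Filter.atTop (nhds u) →
      (∃ M : ℝ, ∀ n, ‖S.B t (c n)‖ ≤ M) →
      u ∈ S.DB t ∧ Filter.Tendsto (fun n => S.B t (c n)) Filter.atTop (nhds (S.B t u)))
    :
    ∀ τ : ℝ, 0 < τ → ∀ f : ℝ → E, Integrable f (volume.restrict (Set.Ioi (0:ℝ))) →
      ∀ᵐ s ∂(volume.restrict (Set.Ioi τ)),
        (∫ r in (0:ℝ)..τ, S.U s r (f r)) ∈ S.DB s ∧
        S.B s (S.U s τ (∫ r in (0:ℝ)..τ, S.U τ r (f r)))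
          = S.B s (∫ r in (0:ℝ)..τ, S.U s r (f r)) ∧
        S.B s (∫ r in (0:ℝ)..τ, S.U s r (f r)) = ∫ r in (0:ℝ)..τ, S.B s (S.U s r (f r)) := by
  have hHB' : IncClosed S := hHB
  intro τ hτ f hf
  have hτ0 := hτ.le
  set g : ℝ → E := fun r => S.U τ r (f r) with hgdef
  have hg : Integrable g (volume.restrict (Ioc 0 τ)) := int_g S hτ f hf
  have hUint : ∀ s, τ < s →
      (∫ r in (0:ℝ)..τ, S.U s r (f r)) = S.U s τ (∫ r in (0:ℝ)..τ, g r) := by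
    intro s hs
    rw [intervalIntegral.integral_of_le hτ0, intervalIntegral.integral_of_le hτ0,
      ← (S.U s τ).integral_comp_comm hg]
    refine setIntegral_congr_fun measurableSet_Ioc fun r hr => ?_
    exact S.U_comp s τ r hr.1.le hr.2 hs.le (f r)
  -- the joint function
  have hsub : Ioi τ ×ˢ Ioc 0 τ ⊆ {p : ℝ × ℝ | 0 ≤ p.2 ∧ p.2 ≤ p.1} := by
    rintro ⟨s, r⟩ ⟨h1, h2⟩
    exact ⟨h2.1.le, h2.2.trans (le_of_lt h1)⟩
  have hHm0 := (hH1meas f hf).mono_measure (Measure.restrict_mono hsub le_rfl)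
  have hprod : (volume : Measure (ℝ × ℝ)).restrict (Ioi τ ×ˢ Ioc 0 τ)
      = (volume.restrict (Ioi τ)).prod (volume.restrict (Ioc 0 τ)) := by
    rw [Measure.prod_restrict, Measure.volume_eq_prod]
  have hHm : AEStronglyMeasurable (fun p : ℝ × ℝ => S.B p.1 (S.U p.1 τ (g p.2)))
      ((volume.restrict (Ioi τ)).prod (volume.restrict (Ioc 0 τ))) := by
    rw [← hprod]
    refine hHm0.congr ?_
    filter_upwards [ae_restrict_mem (measurableSet_Ioi.prod measurableSet_Ioc)] with p hp
    rw [S.U_comp p.1 τ p.2 hp.2.1.le hp.2.2 (le_of_lt hp.1)]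
  obtain ⟨C, hC, hCb⟩ := norm_int_T S hHB' hτ0
  have hHi : Integrable (fun p : ℝ × ℝ => S.B p.1 (S.U p.1 τ (g p.2)))
      ((volume.restrict (Ioi τ)).prod (volume.restrict (Ioc 0 τ))) := by
    rw [integrable_prod_iff' hHm]
    refine ⟨Eventually.of_forall fun r => int_T S hHB' hτ0 (g r), ?_⟩
    refine Integrable.mono' (hg.norm.const_mul C) ?_ (Eventually.of_forall fun r => ?_)
    · exact hHm.norm.prod_swap.integral_prod_right'
    · rw [Real.norm_of_nonneg (integral_nonneg fun _ => norm_nonneg _)]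
      exact hCb (g r)
  have hmain : (fun s => S.B s (S.U s τ (∫ r in Ioc 0 τ, g r)))
      =ᵐ[volume.restrict (Ioi τ)] fun s => ∫ r in Ioc 0 τ, S.B s (S.U s τ (g r)) := by
    refine Integrable.ae_eq_of_forall_setIntegral_eq _ _ (int_T S hHB' hτ0 _)
      hHi.integral_prod_left ?_
    intro A hA _
    obtain ⟨L, hL⟩ := clm_A S hHB' hτ0 A
    rw [← hL, ← L.integral_comp_comm hg]
    simp only [hL]
    refine (integral_integral_swap ?_).symm
    refine hHi.mono_measure ?_
    exact Measure.prod_mono Measure.restrict_le_self le_rfl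
  filter_upwards [hmain, dom_ae S hτ0 (∫ r in (0:ℝ)..τ, g r),
    ae_restrict_mem measurableSet_Ioi] with s h1 h2 hs
  rw [hUint s hs]
  refine ⟨h2, rfl, ?_⟩
  rw [intervalIntegral.integral_of_le hτ0, intervalIntegral.integral_of_le hτ0, h1]
  refine setIntegral_congr_fun measurableSet_Ioc fun r hr => ?_
  change S.B s (S.U s τ (S.U τ r (f r))) = _
  rw [S.U_comp s τ r hr.1.le hr.2 (le_of_lt hs)]
end

section
/- Let Ω ⊆ ℝ^d open, μ a Borel measure with support V, Λ = Ω × V, and let Σ, b satisfy the kinetic assumptions including subcriticality. Then for every nonnegative f ∈ L¹(Λ, dx⊗dμ(v)) and every s ≥ 0: U(t,s)f ∈ D(B(t)) for almost every t ≥ s, the map t ∈ [s,∞) ↦ B(t)U(t,s)f is measurable, and for all r ≥ s: ∫_s^r ‖B(t)U(t,s)f‖ dt ≤ ∫_s^r ‖Σ(t)U(t,s)f‖ dt ≤ ‖f‖ − ‖U(r,s)f‖, where all norms are in L¹(Λ, dx⊗dμ(v)). -/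
open MeasureTheory Set Filter Topology
open scoped ENNReal

/-- Exit time of the point `x` with velocity `-v` from the open set `Ω`
(`+∞` if the backward ray stays in `Ω`). -/
noncomputable def exitTime {d : ℕ} (Ω : Set (EuclideanSpace ℝ (Fin d)))
    (x v : EuclideanSpace ℝ (Fin d)) : ℝ≥0∞ :=
  sInf (ENNReal.ofReal '' {t : ℝ | 0 < t ∧ x - t • v ∉ Ω})

/-- The free streaming (absorption) evolution family on `L¹(Ω × V)`:
`[U(t,s)f](x,v) = exp(-∫_s^t Σ(τ,v) dτ) f(x-(t-s)v, v) 1_{t-s < τ(x,v)}`. -/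
noncomputable def freeStream {d : ℕ} (Ω : Set (EuclideanSpace ℝ (Fin d)))
    (Sig : ℝ → EuclideanSpace ℝ (Fin d) → ℝ) (t s : ℝ)
    (f : EuclideanSpace ℝ (Fin d) × EuclideanSpace ℝ (Fin d) → ℝ)
    (p : EuclideanSpace ℝ (Fin d) × EuclideanSpace ℝ (Fin d)) : ℝ :=
  if ENNReal.ofReal (t - s) < exitTime Ω p.1 p.2 then
    Real.exp (-(∫ τ in s..t, Sig τ p.2)) * f (p.1 - (t - s) • p.2, p.2)
  else 0

/-- Set of `(t, x, v)` whose backward segment of length `t - s` stays in `Ω`. -/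
def segSet {d : ℕ} (Ω : Set (EuclideanSpace ℝ (Fin d))) (s : ℝ) :
    Set (ℝ × EuclideanSpace ℝ (Fin d) × EuclideanSpace ℝ (Fin d)) :=
  {q | ∀ u ∈ Set.Icc (0:ℝ) 1, q.2.1 - (u * (q.1 - s)) • q.2.2 ∈ Ω}

lemma isOpen_segSet {d : ℕ} (Ω : Set (EuclideanSpace ℝ (Fin d))) (hΩ : IsOpen Ω) (s : ℝ) :
    IsOpen (segSet Ω s) := by
  rw [isOpen_iff_mem_nhds]
  intro q hq
  refine (isCompact_Icc (a := (0:ℝ)) (b := 1)).eventually_forall_of_forall_eventually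
    (x₀ := q) (P := fun q u => q.2.1 - (u * (q.1 - s)) • q.2.2 ∈ Ω) ?_
  intro u hu
  have hc : Continuous (fun z : (ℝ × EuclideanSpace ℝ (Fin d) × EuclideanSpace ℝ (Fin d)) × ℝ =>
      z.1.2.1 - (z.2 * (z.1.1 - s)) • z.1.2.2) := by fun_prop
  exact hc.continuousAt.eventually (hΩ.mem_nhds (hq u hu))

lemma lt_exitTime_iff {d : ℕ} (Ω : Set (EuclideanSpace ℝ (Fin d))) (hΩ : IsOpen Ω) {s t : ℝ}
    (hst : s ≤ t) {x v : EuclideanSpace ℝ (Fin d)} (hx : x ∈ Ω) :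
    ENNReal.ofReal (t - s) < exitTime Ω x v ↔ (t, x, v) ∈ segSet Ω s := by
  constructor
  · intro h u hu
    by_contra hn
    simp only at hn
    have h0 : 0 ≤ u * (t - s) := mul_nonneg hu.1 (by linarith)
    have hpos : 0 < u * (t - s) := by
      rcases h0.lt_or_eq with h1 | h1
      · exact h1
      · rw [← h1] at hn
        simp [hx] at hn
    have h2 : exitTime Ω x v ≤ ENNReal.ofReal (u * (t - s)) :=
      sInf_le ⟨_, ⟨hpos, hn⟩, rfl⟩
    have h3 : ENNReal.ofReal (u * (t - s)) ≤ ENNReal.ofReal (t - s) :=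
      ENNReal.ofReal_le_ofReal (by nlinarith [hu.2])
    exact absurd h (not_lt.2 (h2.trans h3))
  · intro h
    have hmem : x - (t - s) • v ∈ Ω := by
      have := h 1 (by simp)
      simpa using this
    have hc : Continuous (fun w : ℝ => x - w • v) := by fun_prop
    have hev : ∀ᶠ w in 𝓝 (t - s), x - w • v ∈ Ω :=
      hc.continuousAt.eventually (hΩ.mem_nhds hmem)
    obtain ⟨ε, hε, hball⟩ := Metric.eventually_nhds_iff.1 hev
    have h1 : ENNReal.ofReal (t - s) < ENNReal.ofReal (t - s + ε) :=
      (ENNReal.ofReal_lt_ofReal_iff (by linarith)).2 (by linarith)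
    refine h1.trans_le (le_sInf ?_)
    rintro _ ⟨w, ⟨hw0, hw⟩, rfl⟩
    apply ENNReal.ofReal_le_ofReal
    by_contra hlt
    push Not at hlt
    apply hw
    rcases le_or_gt w (t - s) with hle | hgt
    · have hp : 0 < t - s := by linarith
      have := h (w / (t - s)) ⟨by positivity, (div_le_one hp).2 hle⟩
      simp only at this
      rwa [div_mul_cancel₀ _ hp.ne'] at this
    · apply hball
      rw [Real.dist_eq, abs_lt]
      constructor <;> linarith

/-- absorption factor -/
noncomputable def absorb {d : ℕ} (Sig : ℝ → EuclideanSpace ℝ (Fin d) → ℝ) (s : ℝ)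
    (q : ℝ × EuclideanSpace ℝ (Fin d)) : ℝ :=
  Real.exp (-(∫ τ, (Set.Ioc s q.1).indicator (fun τ => Sig τ q.2) τ))

lemma absorb_nonneg {d : ℕ} (Sig : ℝ → EuclideanSpace ℝ (Fin d) → ℝ) (s : ℝ)
    (q : ℝ × EuclideanSpace ℝ (Fin d)) : 0 ≤ absorb Sig s q := (Real.exp_pos _).le

lemma absorb_eq {d : ℕ} (Sig : ℝ → EuclideanSpace ℝ (Fin d) → ℝ) {s t : ℝ} (hst : s ≤ t)
    (v : EuclideanSpace ℝ (Fin d)) :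
    absorb Sig s (t, v) = Real.exp (-(∫ τ in s..t, Sig τ v)) := by
  simp only [absorb]
  rw [integral_indicator measurableSet_Ioc, intervalIntegral.integral_of_le hst]

lemma measurable_absorb {d : ℕ} (Sig : ℝ → EuclideanSpace ℝ (Fin d) → ℝ)
    (hS : Measurable (Function.uncurry Sig)) (s : ℝ) : Measurable (absorb Sig s) := by
  unfold absorb
  refine Real.measurable_exp.comp (Measurable.neg ?_)
  have hm : Measurable (fun z : (ℝ × EuclideanSpace ℝ (Fin d)) × ℝ =>
      (Set.Ioc s z.1.1).indicator (fun τ => Sig τ z.1.2) z.2) := by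
    have : (fun z : (ℝ × EuclideanSpace ℝ (Fin d)) × ℝ =>
      (Set.Ioc s z.1.1).indicator (fun τ => Sig τ z.1.2) z.2) =
      Set.indicator {z : (ℝ × EuclideanSpace ℝ (Fin d)) × ℝ | s < z.2 ∧ z.2 ≤ z.1.1}
        (fun z => Function.uncurry Sig (z.2, z.1.2)) := by
      funext z
      simp [Set.indicator, Function.uncurry]
    rw [this]
    refine Measurable.indicator (hS.comp (by fun_prop)) ?_
    exact (measurableSet_lt measurable_const measurable_snd).inter
      (measurableSet_le measurable_snd (measurable_fst.comp measurable_fst))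
  exact (hm.stronglyMeasurable.integral_prod_right).measurable

/-- measurable version of `freeStream` -/
noncomputable def gStream {d : ℕ} (Ω : Set (EuclideanSpace ℝ (Fin d)))
    (Sig : ℝ → EuclideanSpace ℝ (Fin d) → ℝ) (s : ℝ)
    (f : EuclideanSpace ℝ (Fin d) × EuclideanSpace ℝ (Fin d) → ℝ) :
    ℝ × EuclideanSpace ℝ (Fin d) × EuclideanSpace ℝ (Fin d) → ℝ :=
  (segSet Ω s).indicator
    (fun q => absorb Sig s (q.1, q.2.2) * f (q.2.1 - (q.1 - s) • q.2.2, q.2.2))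

lemma freeStream_eq {d : ℕ} (Ω : Set (EuclideanSpace ℝ (Fin d))) (hΩ : IsOpen Ω)
    (Sig : ℝ → EuclideanSpace ℝ (Fin d) → ℝ) {s t : ℝ} (hst : s ≤ t)
    (f : EuclideanSpace ℝ (Fin d) × EuclideanSpace ℝ (Fin d) → ℝ)
    {x : EuclideanSpace ℝ (Fin d)} (hx : x ∈ Ω) (v : EuclideanSpace ℝ (Fin d)) :
    freeStream Ω Sig t s f (x, v) = gStream Ω Sig s f (t, x, v) := by
  classical
  unfold freeStream gStream
  rw [Set.indicator_apply]
  simp only [lt_exitTime_iff Ω hΩ hst hx, absorb_eq Sig hst]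

lemma measurable_gStream {d : ℕ} (Ω : Set (EuclideanSpace ℝ (Fin d))) (hΩ : IsOpen Ω)
    (Sig : ℝ → EuclideanSpace ℝ (Fin d) → ℝ) (hS : Measurable (Function.uncurry Sig)) (s : ℝ)
    (f : EuclideanSpace ℝ (Fin d) × EuclideanSpace ℝ (Fin d) → ℝ) (hf : Measurable f) :
    Measurable (gStream Ω Sig s f) := by
  unfold gStream
  refine Measurable.indicator ?_ (isOpen_segSet Ω hΩ s).measurableSet
  refine Measurable.mul ((measurable_absorb Sig hS s).comp (by fun_prop)) (hf.comp (by fun_prop))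

lemma gStream_nonneg {d : ℕ} (Ω : Set (EuclideanSpace ℝ (Fin d)))
    (Sig : ℝ → EuclideanSpace ℝ (Fin d) → ℝ) (s : ℝ)
    (f : EuclideanSpace ℝ (Fin d) × EuclideanSpace ℝ (Fin d) → ℝ) (hf : ∀ p, 0 ≤ f p) (q) :
    0 ≤ gStream Ω Sig s f q :=
  Set.indicator_nonneg (fun _ _ => mul_nonneg (Real.exp_pos _).le (hf _)) q

/-- One-dimensional inequality along characteristics. -/
lemma key_ineq {d : ℕ} (Sig : ℝ → EuclideanSpace ℝ (Fin d) → ℝ)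
    (hSpos : ∀ t v, 0 ≤ Sig t v) (v : EuclideanSpace ℝ (Fin d)) {s r : ℝ} (hs : 0 ≤ s)
    (hsr : s ≤ r) (hv : ∀ T : ℝ, IntegrableOn (fun t => Sig t v) (Set.Icc 0 T) volume) :
    (∫⁻ t in Set.Ioc s r, ENNReal.ofReal (Sig t v) * ENNReal.ofReal (absorb Sig s (t, v)))
      + ENNReal.ofReal (absorb Sig s (r, v)) ≤ 1 := by
  set F : ℝ → ℝ := fun t => -Real.exp (-(∫ τ in s..t, Sig τ v)) with hF
  have hint : ∀ a b : ℝ, 0 ≤ a → a ≤ b → IntervalIntegrable (fun t => Sig t v) volume a b := by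
    intro a b ha hab
    rw [intervalIntegrable_iff_integrableOn_Ioc_of_le hab]
    exact (hv b).mono_set (fun x hx => ⟨ha.trans hx.1.le, hx.2⟩)
  have hmono : MonotoneOn F (Set.uIcc s r) := by
    rw [Set.uIcc_of_le hsr]
    intro a ha b hb hab
    have h1 : (∫ τ in s..a, Sig τ v) + (∫ τ in a..b, Sig τ v) = ∫ τ in s..b, Sig τ v :=
      intervalIntegral.integral_add_adjacent_intervals (hint s a hs ha.1)
        (hint a b (hs.trans ha.1) hab)
    have h2 : 0 ≤ ∫ τ in a..b, Sig τ v :=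
      intervalIntegral.integral_nonneg hab (fun u _ => hSpos u v)
    simp only [hF]
    apply neg_le_neg
    apply Real.exp_le_exp.2
    linarith
  have hder : ∀ᵐ t ∂(volume.restrict (Set.Ioc s r)),
      deriv F t = Sig t v * absorb Sig s (t, v) := by
    rw [ae_restrict_iff' measurableSet_Ioc]
    filter_upwards [(hint s r hs hsr).ae_hasDerivAt_integral] with t ht htm
    have htm' : t ∈ Set.uIcc s r := by
      rw [Set.uIcc_of_le hsr]; exact ⟨htm.1.le, htm.2⟩
    have h := ht htm' s (by simp)
    have h2 : HasDerivAt F _ t := h.neg.exp.neg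
    rw [h2.deriv, absorb_eq Sig htm.1.le]
    simp only [Pi.neg_apply]
    ring
  have hi : IntegrableOn (deriv F) (Set.Ioc s r) volume :=
    (intervalIntegrable_iff_integrableOn_Ioc_of_le hsr).1 hmono.intervalIntegrable_deriv
  have hnn : 0 ≤ᵐ[volume.restrict (Set.Ioc s r)] deriv F := by
    filter_upwards [hder] with t ht
    rw [ht]
    exact mul_nonneg (hSpos t v) (Real.exp_pos _).le
  have hle : ∫ t in s..r, deriv F t ≤ F r - F s := by
    have hm := hmono.intervalIntegral_deriv_mem_uIcc
    have : F s ≤ F r := hmono (by simp) (by simp) hsr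
    rw [Set.uIcc_of_le (by linarith)] at hm
    exact hm.2
  have heq : (∫⁻ t in Set.Ioc s r, ENNReal.ofReal (Sig t v) * ENNReal.ofReal (absorb Sig s (t, v)))
      = ENNReal.ofReal (∫ t in s..r, deriv F t) := by
    rw [intervalIntegral.integral_of_le hsr, ofReal_integral_eq_lintegral_ofReal hi hnn]
    apply lintegral_congr_ae
    filter_upwards [hder] with t ht
    rw [ht, ENNReal.ofReal_mul (hSpos t v)]
  have h0 : 0 ≤ ∫ t in s..r, deriv F t := by
    rw [intervalIntegral.integral_of_le hsr]
    exact integral_nonneg_of_ae hnn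
  have hFs : F s = -1 := by simp [hF]
  have hFr : F r = - absorb Sig s (r, v) := by rw [absorb_eq Sig hsr]
  rw [heq, ← ENNReal.ofReal_add h0 (absorb_nonneg _ _ _), ← ENNReal.ofReal_one]
  apply ENNReal.ofReal_le_ofReal
  rw [hFs, hFr] at hle
  linarith

/-- a.e. point of the product lies over `Ω`. -/
lemma ae_fst_mem {d : ℕ} (μ : Measure (EuclideanSpace ℝ (Fin d))) [SFinite μ]
    (Ω : Set (EuclideanSpace ℝ (Fin d))) (hΩ : IsOpen Ω) :
    ∀ᵐ p ∂((volume.restrict Ω).prod μ), p.1 ∈ Ω :=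
  Measure.quasiMeasurePreserving_fst.ae (ae_restrict_mem hΩ.measurableSet)

lemma stream_le {d : ℕ} (μ : Measure (EuclideanSpace ℝ (Fin d))) [SFinite μ]
    (Ω : Set (EuclideanSpace ℝ (Fin d))) (hΩ : IsOpen Ω)
    (Sig : ℝ → EuclideanSpace ℝ (Fin d) → ℝ) (hS : Measurable (Function.uncurry Sig))
    (f : EuclideanSpace ℝ (Fin d) × EuclideanSpace ℝ (Fin d) → ℝ)
    (hf : Measurable f) {s t : ℝ} (hst : s ≤ t)
    (w : EuclideanSpace ℝ (Fin d) → ℝ≥0∞) (hw : Measurable w) :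
    (∫⁻ p, w p.2 * ENNReal.ofReal (freeStream Ω Sig t s f p) ∂((volume.restrict Ω).prod μ))
      ≤ ∫⁻ p, w p.2 * ENNReal.ofReal (absorb Sig s (t, p.2)) * ENNReal.ofReal (f p)
          ∂((volume.restrict Ω).prod μ) := by
  have hg := measurable_gStream Ω hΩ Sig hS s f hf
  have ha := measurable_absorb Sig hS s
  have h1 : (∫⁻ p, w p.2 * ENNReal.ofReal (freeStream Ω Sig t s f p)
        ∂((volume.restrict Ω).prod μ))
      = ∫⁻ p, w p.2 * ENNReal.ofReal (gStream Ω Sig s f (t, p)) ∂((volume.restrict Ω).prod μ) := by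
    apply lintegral_congr_ae
    filter_upwards [ae_fst_mem μ Ω hΩ] with p hp
    rw [← freeStream_eq Ω hΩ Sig hst f hp p.2]
  have hm1 : Measurable (fun p : EuclideanSpace ℝ (Fin d) × EuclideanSpace ℝ (Fin d) =>
      w p.2 * ENNReal.ofReal (gStream Ω Sig s f (t, p))) :=
    (hw.comp measurable_snd).mul (hg.comp (by fun_prop)).ennreal_ofReal
  have hm2 : Measurable (fun p : EuclideanSpace ℝ (Fin d) × EuclideanSpace ℝ (Fin d) =>
      w p.2 * ENNReal.ofReal (absorb Sig s (t, p.2)) * ENNReal.ofReal (f p)) :=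
    ((hw.comp measurable_snd).mul (ha.comp (by fun_prop)).ennreal_ofReal).mul hf.ennreal_ofReal
  rw [h1, lintegral_prod_symm' _ hm1, lintegral_prod_symm' _ hm2]
  apply lintegral_mono
  intro v
  simp only
  set h : EuclideanSpace ℝ (Fin d) → ℝ≥0∞ := Ω.indicator
    (fun x => w v * ENNReal.ofReal (absorb Sig s (t, v)) * ENNReal.ofReal (f (x, v))) with hh
  calc (∫⁻ x in Ω, w v * ENNReal.ofReal (gStream Ω Sig s f (t, x, v)))
      ≤ ∫⁻ x in Ω, h (x - (t - s) • v) := by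
        apply lintegral_mono
        intro x
        by_cases hx : (t, x, v) ∈ segSet Ω s
        · have hmem : x - (t - s) • v ∈ Ω := by
            have := hx 1 (by simp)
            simpa using this
          simp only [hh, gStream, Set.indicator_of_mem hx, Set.indicator_of_mem hmem]
          rw [ENNReal.ofReal_mul (absorb_nonneg _ _ _), mul_assoc]
        · simp [gStream, Set.indicator_of_notMem hx]
    _ ≤ ∫⁻ x, h (x - (t - s) • v) := setLIntegral_le_lintegral _ _
    _ = ∫⁻ x, h x := lintegral_sub_right_eq_self h _
    _ = _ := by rw [hh, lintegral_indicator hΩ.measurableSet]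

theorem honesty_stmt17 {d : ℕ} (μ : Measure (EuclideanSpace ℝ (Fin d))) [SFinite μ]
    (Ω : Set (EuclideanSpace ℝ (Fin d))) (hΩ : IsOpen Ω)
    (Sig : ℝ → EuclideanSpace ℝ (Fin d) → ℝ)
    (b : ℝ → EuclideanSpace ℝ (Fin d) → EuclideanSpace ℝ (Fin d) → ℝ)
    (hSmeas : Measurable (Function.uncurry Sig))
    (hSpos : ∀ t v, 0 ≤ Sig t v)
    (hSloc : ∀ᵐ v ∂μ, ∀ T : ℝ, IntegrableOn (fun t => Sig t v) (Set.Icc 0 T) volume)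
    (hbmeas : Measurable (fun q : ℝ × EuclideanSpace ℝ (Fin d) × EuclideanSpace ℝ (Fin d) =>
      b q.1 q.2.1 q.2.2))
    (hbpos : ∀ t v v', 0 ≤ b t v v')
    (hsub : ∀ᵐ p : ℝ × EuclideanSpace ℝ (Fin d) ∂((volume.restrict (Set.Ici (0:ℝ))).prod μ),
      (∫⁻ v, ENNReal.ofReal (b p.1 v p.2) ∂μ) ≤ ENNReal.ofReal (Sig p.1 p.2))
    (f : EuclideanSpace ℝ (Fin d) × EuclideanSpace ℝ (Fin d) → ℝ)
    (hfmeas : Measurable f) (hfpos : ∀ p, 0 ≤ f p)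
    (hfint : Integrable f ((volume.restrict Ω).prod μ))
    (s : ℝ) (hs : 0 ≤ s) :
    (∀ᵐ t ∂(volume.restrict (Set.Ici s)),
      (∫⁻ p, (∫⁻ v', ENNReal.ofReal (b t v' p.2) ∂μ) *
          ENNReal.ofReal (freeStream Ω Sig t s f p) ∂((volume.restrict Ω).prod μ)) < ⊤) ∧
    (AEMeasurable
      (fun q : ℝ × EuclideanSpace ℝ (Fin d) × EuclideanSpace ℝ (Fin d) =>
        ∫⁻ v', ENNReal.ofReal (b q.1 q.2.2 v' * freeStream Ω Sig q.1 s f (q.2.1, v')) ∂μ)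
      ((volume.restrict (Set.Ici s)).prod ((volume.restrict Ω).prod μ))) ∧
    (∀ r : ℝ, s ≤ r →
      (∫⁻ t in Set.Ioc s r, ∫⁻ p,
          (∫⁻ v', ENNReal.ofReal (b t p.2 v' * freeStream Ω Sig t s f (p.1, v')) ∂μ)
          ∂((volume.restrict Ω).prod μ))
        ≤ ∫⁻ t in Set.Ioc s r, ∫⁻ p,
            ENNReal.ofReal (Sig t p.2 * freeStream Ω Sig t s f p)
            ∂((volume.restrict Ω).prod μ)) ∧
    (∀ r : ℝ, s ≤ r →
      (∫⁻ t in Set.Ioc s r, ∫⁻ p,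
          ENNReal.ofReal (Sig t p.2 * freeStream Ω Sig t s f p)
          ∂((volume.restrict Ω).prod μ))
        + (∫⁻ p, ENNReal.ofReal (freeStream Ω Sig r s f p) ∂((volume.restrict Ω).prod μ))
        ≤ ∫⁻ p, ENNReal.ofReal (f p) ∂((volume.restrict Ω).prod μ)) := by
  have hg := measurable_gStream Ω hΩ Sig hSmeas s f hfmeas
  have hgn := gStream_nonneg Ω Sig s f hfpos
  have ha := measurable_absorb Sig hSmeas s
  -- part 4
  have P4 : ∀ r : ℝ, s ≤ r →
      (∫⁻ t in Set.Ioc s r, ∫⁻ p,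
          ENNReal.ofReal (Sig t p.2 * freeStream Ω Sig t s f p)
          ∂((volume.restrict Ω).prod μ))
        + (∫⁻ p, ENNReal.ofReal (freeStream Ω Sig r s f p) ∂((volume.restrict Ω).prod μ))
        ≤ ∫⁻ p, ENNReal.ofReal (f p) ∂((volume.restrict Ω).prod μ) := by
    intro r hsr
    have hSt : ∀ t, Measurable (fun v => ENNReal.ofReal (Sig t v)) := fun t =>
      (hSmeas.comp (measurable_prodMk_left (x := t))).ennreal_ofReal
    have hM : Measurable (fun z : ℝ × EuclideanSpace ℝ (Fin d) × EuclideanSpace ℝ (Fin d) =>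
        ENNReal.ofReal (Sig z.1 z.2.2) * ENNReal.ofReal (absorb Sig s (z.1, z.2.2)) *
          ENNReal.ofReal (f z.2)) := by
      refine Measurable.mul (Measurable.mul ?_ ?_) (hfmeas.comp measurable_snd).ennreal_ofReal
      · exact (hSmeas.comp (by fun_prop :
          Measurable (fun z : ℝ × EuclideanSpace ℝ (Fin d) × EuclideanSpace ℝ (Fin d) =>
            (z.1, z.2.2)))).ennreal_ofReal
      · exact (ha.comp (by fun_prop)).ennreal_ofReal
    have hM2 : Measurable (fun z : ℝ × EuclideanSpace ℝ (Fin d) =>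
        ENNReal.ofReal (Sig z.1 z.2) * ENNReal.ofReal (absorb Sig s z)) :=
      hSmeas.ennreal_ofReal.mul ha.ennreal_ofReal
    have hA : (∫⁻ t in Set.Ioc s r, ∫⁻ p,
          ENNReal.ofReal (Sig t p.2 * freeStream Ω Sig t s f p) ∂((volume.restrict Ω).prod μ))
        ≤ ∫⁻ p, (∫⁻ t in Set.Ioc s r,
            ENNReal.ofReal (Sig t p.2) * ENNReal.ofReal (absorb Sig s (t, p.2))) *
            ENNReal.ofReal (f p) ∂((volume.restrict Ω).prod μ) := by
      calc _ ≤ ∫⁻ t in Set.Ioc s r, ∫⁻ p, ENNReal.ofReal (Sig t p.2) *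
              ENNReal.ofReal (absorb Sig s (t, p.2)) * ENNReal.ofReal (f p)
              ∂((volume.restrict Ω).prod μ) := by
            apply setLIntegral_mono' measurableSet_Ioc
            intro t ht
            simp only [ENNReal.ofReal_mul (hSpos t _)]
            exact stream_le μ Ω hΩ Sig hSmeas f hfmeas ht.1.le _ (hSt t)
        _ = ∫⁻ p, (∫⁻ t in Set.Ioc s r, ENNReal.ofReal (Sig t p.2) *
              ENNReal.ofReal (absorb Sig s (t, p.2)) * ENNReal.ofReal (f p))
              ∂((volume.restrict Ω).prod μ) :=
            lintegral_lintegral_swap hM.aemeasurable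
        _ = _ := by
            apply lintegral_congr
            intro p
            rw [lintegral_mul_const]
            exact hM2.comp (measurable_prodMk_right (y := p.2))
    have hB := stream_le μ Ω hΩ Sig hSmeas f hfmeas hsr (fun _ => 1) measurable_const
    simp only [one_mul] at hB
    refine (add_le_add hA hB).trans ?_
    rw [← lintegral_add_right]
    · apply lintegral_mono_ae
      have hae : ∀ᵐ p ∂((volume.restrict Ω).prod μ),
          ∀ T : ℝ, IntegrableOn (fun t => Sig t p.2) (Set.Icc 0 T) volume :=
        Measure.quasiMeasurePreserving_snd.ae hSloc
      filter_upwards [hae] with p hp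
      rw [← add_mul]
      exact mul_le_of_le_one_left (zero_le) (key_ineq Sig hSpos p.2 hs hsr hp)
    · exact (ha.comp (by fun_prop)).ennreal_ofReal.mul hfmeas.ennreal_ofReal
  -- subcriticality for a.e. time
  have hsub' : ∀ᵐ t ∂(volume.restrict (Set.Ici s)), ∀ᵐ v ∂μ,
      (∫⁻ v', ENNReal.ofReal (b t v' v) ∂μ) ≤ ENNReal.ofReal (Sig t v) :=
    ae_mono (Measure.restrict_mono (Set.Ici_subset_Ici.2 hs) le_rfl)
      (Measure.ae_ae_of_ae_prod hsub)
  have hsub2 : ∀ᵐ t ∂(volume.restrict (Set.Ici s)),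
      (∫⁻ p, (∫⁻ v', ENNReal.ofReal (b t v' p.2) ∂μ) *
          ENNReal.ofReal (freeStream Ω Sig t s f p) ∂((volume.restrict Ω).prod μ)) ≤
      ∫⁻ p, ENNReal.ofReal (Sig t p.2 * freeStream Ω Sig t s f p)
            ∂((volume.restrict Ω).prod μ) := by
    filter_upwards [hsub'] with t ht
    apply lintegral_mono_ae
    have hae : ∀ᵐ p ∂((volume.restrict Ω).prod μ),
        (∫⁻ v', ENNReal.ofReal (b t v' p.2) ∂μ) ≤ ENNReal.ofReal (Sig t p.2) :=
      Measure.quasiMeasurePreserving_snd.ae ht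
    filter_upwards [hae] with p hp
    rw [ENNReal.ofReal_mul (hSpos _ _)]
    gcongr
  have hfin : (∫⁻ p, ENNReal.ofReal (f p) ∂((volume.restrict Ω).prod μ)) ≠ ⊤ :=
    ((hasFiniteIntegral_iff_ofReal (Eventually.of_forall hfpos)).1 hfint.2).ne
  -- measurable representative of `t ↦ ‖Σ(t)U(t,s)f‖`
  have hN : Measurable (fun t => ∫⁻ p, ENNReal.ofReal (Sig t p.2 * gStream Ω Sig s f (t, p))
      ∂((volume.restrict Ω).prod μ)) := by
    have : Measurable (fun z : ℝ × EuclideanSpace ℝ (Fin d) × EuclideanSpace ℝ (Fin d) =>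
        ENNReal.ofReal (Sig z.1 z.2.2 * gStream Ω Sig s f (z.1, z.2))) :=
      ((hSmeas.comp (by fun_prop :
          Measurable (fun z : ℝ × EuclideanSpace ℝ (Fin d) × EuclideanSpace ℝ (Fin d) =>
            (z.1, z.2.2)))).mul (hg.comp (by fun_prop))).ennreal_ofReal
    exact this.lintegral_prod_right'
  have hNeq : ∀ t, s ≤ t → (∫⁻ p, ENNReal.ofReal (Sig t p.2 * freeStream Ω Sig t s f p)
            ∂((volume.restrict Ω).prod μ)) =
      ∫⁻ p, ENNReal.ofReal (Sig t p.2 * gStream Ω Sig s f (t, p))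
      ∂((volume.restrict Ω).prod μ) := by
    intro t ht
    apply lintegral_congr_ae
    filter_upwards [ae_fst_mem μ Ω hΩ] with p hp
    rw [← freeStream_eq Ω hΩ Sig ht f hp p.2]
  refine ⟨?_, ?_, ?_, P4⟩
  · have hfinN : ∀ᵐ t ∂(volume.restrict (Set.Ici s)),
        (∫⁻ p, ENNReal.ofReal (Sig t p.2 * gStream Ω Sig s f (t, p))
          ∂((volume.restrict Ω).prod μ)) < ⊤ := by
      rw [← restrict_Ioi_eq_restrict_Ici]
      have hU : Set.Ioi s = ⋃ n : ℕ, Set.Ioc s (s + n) := by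
        ext x
        simp only [Set.mem_Ioi, Set.mem_iUnion, Set.mem_Ioc]
        constructor
        · intro hx
          obtain ⟨n, hn⟩ := exists_nat_ge (x - s)
          exact ⟨n, hx, by linarith⟩
        · rintro ⟨n, hx, _⟩
          exact hx
      rw [hU, ae_restrict_iUnion_iff]
      intro n
      apply ae_lt_top hN
      refine ne_top_of_le_ne_top hfin ?_
      refine le_trans ?_ (le_self_add.trans (P4 (s + n) (by simp)))
      apply setLIntegral_mono' measurableSet_Ioc
      intro t ht
      exact (hNeq t ht.1.le).ge
    filter_upwards [hsub2, hfinN, ae_restrict_mem measurableSet_Ici] with t h1 h2 h3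
    refine h1.trans_lt ?_
    rw [hNeq t h3]
    exact h2
  · refine ⟨fun q => ∫⁻ v', ENNReal.ofReal (b q.1 q.2.2 v' *
      gStream Ω Sig s f (q.1, q.2.1, v')) ∂μ, ?_, ?_⟩
    · have : Measurable (fun z : (ℝ × EuclideanSpace ℝ (Fin d) × EuclideanSpace ℝ (Fin d)) ×
          EuclideanSpace ℝ (Fin d) =>
          ENNReal.ofReal (b z.1.1 z.1.2.2 z.2 * gStream Ω Sig s f (z.1.1, z.1.2.1, z.2))) :=
        ((hbmeas.comp (by fun_prop :
          Measurable (fun z : (ℝ × EuclideanSpace ℝ (Fin d) × EuclideanSpace ℝ (Fin d)) ×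
            EuclideanSpace ℝ (Fin d) => (z.1.1, z.1.2.2, z.2)))).mul
          (hg.comp (by fun_prop))).ennreal_ofReal
      exact this.lintegral_prod_right'
    · have e1 : ∀ᵐ q ∂((volume.restrict (Set.Ici s)).prod ((volume.restrict Ω).prod μ)),
          q.1 ∈ Set.Ici s :=
        Measure.quasiMeasurePreserving_fst.ae (ae_restrict_mem measurableSet_Ici)
      have e2 : ∀ᵐ q ∂((volume.restrict (Set.Ici s)).prod ((volume.restrict Ω).prod μ)),
          q.2.1 ∈ Ω :=
        Measure.quasiMeasurePreserving_snd.ae (ae_fst_mem μ Ω hΩ)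
      filter_upwards [e1, e2] with q h1 h2
      apply lintegral_congr
      intro v'
      rw [freeStream_eq Ω hΩ Sig h1 f h2 v']
  · intro r hsr
    apply lintegral_mono_ae
    have hsub3 := ae_mono (Measure.restrict_mono
      (fun x (hx : x ∈ Set.Ioc s r) => (hx.1.le : x ∈ Set.Ici s)) (le_refl volume)) hsub2
    filter_upwards [hsub3, ae_restrict_mem measurableSet_Ioc] with t h1 ht
    refine le_trans (le_of_eq ?_) h1
    have hbt : Measurable (fun z : EuclideanSpace ℝ (Fin d) × EuclideanSpace ℝ (Fin d) =>
        b t z.1 z.2) :=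
      hbmeas.comp (measurable_prodMk_left (x := t))
    have hgt : Measurable (fun z : EuclideanSpace ℝ (Fin d) × EuclideanSpace ℝ (Fin d) =>
        gStream Ω Sig s f (t, z)) := hg.comp (measurable_prodMk_left (x := t))
    have hσ : Measurable (fun v => ∫⁻ v', ENNReal.ofReal (b t v' v) ∂μ) :=
      Measurable.lintegral_prod_left' (f := fun z : EuclideanSpace ℝ (Fin d) ×
        EuclideanSpace ℝ (Fin d) => ENNReal.ofReal (b t z.1 z.2)) hbt.ennreal_ofReal
    have hm3 : Measurable (fun z : (EuclideanSpace ℝ (Fin d) × EuclideanSpace ℝ (Fin d)) ×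
          EuclideanSpace ℝ (Fin d) =>
          ENNReal.ofReal (b t z.1.2 z.2 * gStream Ω Sig s f (t, z.1.1, z.2))) :=
      ((hbt.comp (by fun_prop : Measurable (fun z : (EuclideanSpace ℝ (Fin d) ×
          EuclideanSpace ℝ (Fin d)) × EuclideanSpace ℝ (Fin d) => (z.1.2, z.2)))).mul
        (hgt.comp (by fun_prop : Measurable (fun z : (EuclideanSpace ℝ (Fin d) ×
          EuclideanSpace ℝ (Fin d)) × EuclideanSpace ℝ (Fin d) =>
            (z.1.1, z.2))))).ennreal_ofReal
    calc _ = ∫⁻ p, (∫⁻ v', ENNReal.ofReal (b t p.2 v' * gStream Ω Sig s f (t, p.1, v')) ∂μ)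
          ∂((volume.restrict Ω).prod μ) := by
          apply lintegral_congr_ae
          filter_upwards [ae_fst_mem μ Ω hΩ] with p hp
          apply lintegral_congr
          intro v'
          rw [freeStream_eq Ω hΩ Sig ht.1.le f hp v']
      _ = ∫⁻ x in Ω, ∫⁻ v, ∫⁻ v', ENNReal.ofReal (b t v v' * gStream Ω Sig s f (t, x, v')) ∂μ ∂μ :=
          lintegral_prod _ hm3.lintegral_prod_right'.aemeasurable
      _ = ∫⁻ x in Ω, ∫⁻ v', (∫⁻ v, ENNReal.ofReal (b t v v') ∂μ) *
            ENNReal.ofReal (gStream Ω Sig s f (t, x, v')) ∂μ := by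
          apply lintegral_congr
          intro x
          rw [lintegral_lintegral_swap]
          · apply lintegral_congr
            intro v'
            simp only [ENNReal.ofReal_mul (hbpos t _ _)]
            rw [lintegral_mul_const]
            exact (hbt.comp (measurable_prodMk_right (y := v'))).ennreal_ofReal
          · exact (hm3.comp (by fun_prop : Measurable (fun z : EuclideanSpace ℝ (Fin d) ×
              EuclideanSpace ℝ (Fin d) => ((x, z.1), z.2)))).aemeasurable
      _ = ∫⁻ p, (∫⁻ v', ENNReal.ofReal (b t v' p.2) ∂μ) *
            ENNReal.ofReal (gStream Ω Sig s f (t, p)) ∂((volume.restrict Ω).prod μ) :=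
          (lintegral_prod _ ((hσ.comp measurable_snd).mul hgt.ennreal_ofReal).aemeasurable).symm
      _ = _ := by
          apply lintegral_congr_ae
          filter_upwards [ae_fst_mem μ Ω hΩ] with p hp
          rw [← freeStream_eq Ω hΩ Sig ht.1.le f hp p.2]
end
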